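/- For each β ≥ 0 and y ≥ 0, as n → ∞ one has ∫₀^t e^{−βs} R_{Π_n}(ns) ds → ∫₀^t e^{−βs} W′(s) ds and ∫₀^t e^{−βs} R_n(ns, y) ds → y·∫₀^t e^{−βs} W′(s) ds, in both cases uniformly in t on compact subsets of [0,∞). -/

import Mathlib

open MeasureTheory Real Set Filter Topology

noncomputable def tailNu (ν : Measure ℝ) (y : ℝ) : ℝ := (ν (Set.Ici y)).toReal

noncomputable def itailNu (ν : Measure ℝ) (x : ℝ) : ℝ := ∫ y in Set.Ioi x, tailNu ν y

noncomputable def phi (b c : ℝ) (ν : Measure ℝ) (l : ℝ) : ℝ :=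
  b * l + c * l ^ 2 + ∫ y in Set.Ioi (0 : ℝ), (Real.exp (-l * y) - 1 + l * y) ∂ν

noncomputable def expDens (c y : ℝ) : ℝ := (1 / c) * Real.exp (-y / c)

noncomputable def gam (b c : ℝ) (ν : Measure ℝ) (η : ℕ → ℝ) (n : ℕ) : ℝ :=
  (1 / c) * max 0 (1 - b / (n : ℝ) - (1 / (n : ℝ)) * ∫ y in Set.Ioi (0 : ℝ), tailNu ν (η n + y))

noncomputable def piDens (c θn : ℝ) (Λn : Measure ℝ) (y : ℝ) : ℝ :=
  (1 - θn) * expDens c y + θn * ∫ u in Set.Icc (0 : ℝ) y, expDens c (y - u) ∂Λn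

noncomputable def piTail (c θn : ℝ) (Λn : Measure ℝ) (x : ℝ) : ℝ :=
  ∫ y in Set.Ioi x, piDens c θn Λn y

noncomputable def piTailL1 (c θn : ℝ) (Λn : Measure ℝ) : ℝ :=
  ∫ y in Set.Ioi (0 : ℝ), piTail c θn Λn y

noncomputable def convPos (f g : ℝ → ℝ) (x : ℝ) : ℝ := ∫ y in (0 : ℝ)..x, f (x - y) * g y

noncomputable def convIter (f : ℝ → ℝ) : ℕ → ℝ → ℝ
  | 0 => f
  | k + 1 => convPos f (convIter f k)

/-- Resolvent of the second kind of `f`: the sum `Σ_{k≥1} f^{*k}`, set to `0` on `(−∞,0)`. -/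
noncomputable def resolventSnd (f : ℝ → ℝ) (t : ℝ) : ℝ :=
  if t < 0 then 0 else ∑' k : ℕ, convIter f k t

noncomputable def RPi (b c : ℝ) (ν : Measure ℝ) (η θ : ℕ → ℝ) (Λ : ℕ → Measure ℝ)
    (n : ℕ) : ℝ → ℝ :=
  resolventSnd (fun t => gam b c ν η n * piTail c (θ n) (Λ n) t)

noncomputable def Rtwo (b c : ℝ) (ν : Measure ℝ) (η θ : ℕ → ℝ) (Λ : ℕ → Measure ℝ)
    (n : ℕ) (t y : ℝ) : ℝ :=
  if t < 0 ∨ y < 0 then 0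
  else (if t < y then 1 else 0) + ∫ s in (t - y)..t, RPi b c ν η θ Λ n s


theorem aux_polya (F : ℕ → ℝ → ℝ) (G : ℝ → ℝ) (hF : ∀ᶠ n in atTop, Monotone (F n))
    (hG : Continuous G) (h : ∀ t, Tendsto (fun n => F n t) atTop (𝓝 (G t))) :
    TendstoLocallyUniformly F G atTop := by
  rw [Metric.tendstoLocallyUniformly_iff]
  intro ε hε x
  obtain ⟨δ, hδ, hδ'⟩ := Metric.continuous_iff.1 hG x (ε / 4) (by linarith)
  have ha := hδ' (x - δ / 2) (by rw [Real.dist_eq]; rw [abs_lt]; constructor <;> linarith)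
  have hb := hδ' (x + δ / 2) (by rw [Real.dist_eq]; rw [abs_lt]; constructor <;> linarith)
  refine ⟨Icc (x - δ / 2) (x + δ / 2), Icc_mem_nhds (by linarith) (by linarith), ?_⟩
  have e1 := (Metric.tendsto_nhds.1 (h (x - δ / 2))) (ε / 4) (by linarith)
  have e2 := (Metric.tendsto_nhds.1 (h (x + δ / 2))) (ε / 4) (by linarith)
  filter_upwards [hF, e1, e2] with n hn h1 h2 y hy
  have hy1 := hn hy.1
  have hy2 := hn hy.2
  have hc := hδ' y (by rw [Real.dist_eq]; rw [abs_lt]; constructor <;> linarith [hy.1, hy.2])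
  rw [Real.dist_eq, abs_lt] at *
  constructor <;> linarith [h1.1, h1.2, h2.1, h2.2, ha.1, ha.2, hb.1, hb.2, hc.1, hc.2]

theorem aux_lap_poly (r : ℕ → ℝ → ℝ) (w : ℝ → ℝ)
    (hri : ∀ᶠ n in atTop, IntegrableOn (fun s => Real.exp (-s) * r n s) (Ioi 0))
    (hwi : IntegrableOn (fun s => Real.exp (-s) * w s) (Ioi 0))
    (hlim : ∀ k : ℕ, Tendsto (fun n => ∫ s in Ioi (0:ℝ), Real.exp (-((k:ℝ)+1) * s) * r n s) atTop
      (𝓝 (∫ s in Ioi (0:ℝ), Real.exp (-((k:ℝ)+1) * s) * w s))) (p : Polynomial ℝ) :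
    Tendsto (fun n => ∫ s in Ioi (0:ℝ), p.eval (Real.exp (-s)) * (Real.exp (-s) * r n s)) atTop
      (𝓝 (∫ s in Ioi (0:ℝ), p.eval (Real.exp (-s)) * (Real.exp (-s) * w s))) := by
  have key : ∀ (q : Polynomial ℝ) (f : ℝ → ℝ),
      IntegrableOn (fun s => Real.exp (-s) * f s) (Ioi 0) →
      IntegrableOn (fun s => q.eval (Real.exp (-s)) * (Real.exp (-s) * f s)) (Ioi 0) := by
    intro q f hf
    obtain ⟨C, hC⟩ := (isCompact_Icc (a := (0:ℝ)) (b := 1)).exists_bound_of_continuousOn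
      (q.continuous.continuousOn)
    refine Integrable.bdd_mul (c := C) hf ?_ ?_
    · exact (q.continuous.comp (by fun_prop)).aestronglyMeasurable
    · refine (ae_restrict_mem measurableSet_Ioi).mono fun s hs => hC _ ⟨(Real.exp_pos _).le, ?_⟩
      exact Real.exp_le_one_iff.2 (by have := mem_Ioi.1 hs; linarith)
  induction p using Polynomial.induction_on' with
  | add p q hp hq =>
    refine (Tendsto.congr' ?_ ((hp.add hq).trans (le_of_eq ?_)))
    · filter_upwards [hri] with n hn
      rw [← integral_add (key p _ hn) (key q _ hn)]
      simp only [Polynomial.eval_add, add_mul]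
    · rw [← integral_add (key p _ hwi) (key q _ hwi)]
      simp only [Polynomial.eval_add, add_mul]
  | monomial k a =>
    have : ∀ f : ℝ → ℝ, ∫ s in Ioi (0:ℝ), (Polynomial.monomial k a).eval (Real.exp (-s)) * (Real.exp (-s) * f s)
        = a * ∫ s in Ioi (0:ℝ), Real.exp (-((k:ℝ)+1) * s) * f s := by
      intro f
      rw [← integral_const_mul]
      congr 1; ext s
      rw [Polynomial.eval_monomial, ← Real.exp_nat_mul]
      have : Real.exp (-((k:ℝ)+1) * s) = Real.exp (k * -s) * Real.exp (-s) := by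
        rw [← Real.exp_add]; ring_nf
      rw [this]; ring
    simp only [this]
    exact (hlim k).const_mul a

theorem aux_lap_cont (r : ℕ → ℝ → ℝ) (w : ℝ → ℝ)
    (hr0 : ∀ n s, 0 ≤ r n s) (hw0 : ∀ s, 0 ≤ w s)
    (hri : ∀ᶠ n in atTop, IntegrableOn (fun s => Real.exp (-s) * r n s) (Ioi 0))
    (hwi : IntegrableOn (fun s => Real.exp (-s) * w s) (Ioi 0))
    (hlim : ∀ k : ℕ, Tendsto (fun n => ∫ s in Ioi (0:ℝ), Real.exp (-((k:ℝ)+1) * s) * r n s) atTop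
      (𝓝 (∫ s in Ioi (0:ℝ), Real.exp (-((k:ℝ)+1) * s) * w s))) (g : ℝ → ℝ) (hg : Continuous g) :
    Tendsto (fun n => ∫ s in Ioi (0:ℝ), g (Real.exp (-s)) * (Real.exp (-s) * r n s)) atTop
      (𝓝 (∫ s in Ioi (0:ℝ), g (Real.exp (-s)) * (Real.exp (-s) * w s))) := by
  have hx : ∀ s ∈ Ioi (0:ℝ), Real.exp (-s) ∈ Icc (0:ℝ) 1 := fun s hs =>
    ⟨(Real.exp_pos _).le, Real.exp_le_one_iff.2 (by have := mem_Ioi.1 hs; linarith)⟩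
  have key : ∀ (q : ℝ → ℝ) (_ : Continuous q) (f : ℝ → ℝ),
      IntegrableOn (fun s => Real.exp (-s) * f s) (Ioi 0) →
      IntegrableOn (fun s => q (Real.exp (-s)) * (Real.exp (-s) * f s)) (Ioi 0) := by
    intro q hq f hf
    obtain ⟨C, hC⟩ := (isCompact_Icc (a := (0:ℝ)) (b := 1)).exists_bound_of_continuousOn
      (hq.continuousOn)
    refine Integrable.bdd_mul (c := C) hf ?_ ?_
    · exact (hq.comp (by fun_prop)).aestronglyMeasurable
    · exact (ae_restrict_mem measurableSet_Ioi).mono fun s hs => hC _ (hx s hs)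
  have key2 : ∀ (q : ℝ → ℝ) (_ : Continuous q) (δ : ℝ) (_ : ∀ x ∈ Icc (0:ℝ) 1, |q x - g x| < δ)
      (f : ℝ → ℝ), (∀ s, 0 ≤ f s) →
      IntegrableOn (fun s => Real.exp (-s) * f s) (Ioi 0) →
      |(∫ s in Ioi (0:ℝ), q (Real.exp (-s)) * (Real.exp (-s) * f s))
        - ∫ s in Ioi (0:ℝ), g (Real.exp (-s)) * (Real.exp (-s) * f s)| ≤
        δ * ∫ s in Ioi (0:ℝ), Real.exp (-s) * f s := by
    intro q hq δ hδ f hf0 hf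
    rw [← integral_sub (key q hq f hf) (key g hg f hf), ← Real.norm_eq_abs, ← integral_const_mul]
    refine norm_integral_le_of_norm_le (hf.const_mul δ) ?_
    refine (ae_restrict_mem measurableSet_Ioi).mono fun s hs => ?_
    rw [← sub_mul, norm_mul, Real.norm_eq_abs, Real.norm_of_nonneg (mul_nonneg (Real.exp_pos _).le (hf0 s))]
    exact mul_le_mul_of_nonneg_right (hδ _ (hx s hs)).le (mul_nonneg (Real.exp_pos _).le (hf0 s))
  rw [Metric.tendsto_nhds]
  intro ε hε
  have h0 := hlim 0
  simp only [Nat.cast_zero, zero_add, neg_mul, one_mul] at h0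
  set M := ∫ s in Ioi (0:ℝ), Real.exp (-s) * w s with hM
  have hM0 : 0 ≤ M := integral_nonneg fun s => mul_nonneg (Real.exp_pos _).le (hw0 s)
  set δ := ε / (4 * (M + 1)) with hδ
  have hδ0 : 0 < δ := by positivity
  obtain ⟨p, hp⟩ := exists_polynomial_near_of_continuousOn 0 1 g hg.continuousOn δ hδ0
  have h1 := aux_lap_poly r w hri hwi hlim p
  have e1 := Metric.tendsto_nhds.1 h1 (ε / 4) (by linarith)
  have e2 := h0.eventually (gt_mem_nhds (show M < M + 1 by linarith))
  have kw := key2 _ p.continuous δ hp w hw0 hwi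
  filter_upwards [hri, e1, e2] with n hn h1 h2
  have kn := key2 _ p.continuous δ hp (r n) (hr0 n) hn
  have hδM : δ * (M + 1) = ε / 4 := by rw [hδ]; field_simp
  have b1 : δ * M ≤ ε / 4 := by rw [← hδM]; gcongr; linarith
  have b2 : δ * ∫ s in Ioi (0:ℝ), Real.exp (-s) * r n s ≤ ε / 4 := by rw [← hδM]; gcongr
  rw [Real.dist_eq, abs_lt] at *
  rw [abs_le] at kw kn
  constructor <;> linarith [kw.1, kw.2, kn.1, kn.2, h1.1, h1.2]

/-- clamp -/
noncomputable def auxK (a δ s : ℝ) : ℝ := max 0 (min 1 ((a + δ - s) / δ))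

theorem aux_lap_main (r : ℕ → ℝ → ℝ) (w : ℝ → ℝ)
    (hr0 : ∀ n s, 0 ≤ r n s) (hw0 : ∀ s, 0 ≤ w s) (hwc : Continuous w)
    (hri : ∀ᶠ n in atTop, IntegrableOn (fun s => Real.exp (-s) * r n s) (Ioi 0))
    (hwi : IntegrableOn (fun s => Real.exp (-s) * w s) (Ioi 0))
    (hlim : ∀ k : ℕ, Tendsto (fun n => ∫ s in Ioi (0:ℝ), Real.exp (-((k:ℝ)+1) * s) * r n s) atTop
      (𝓝 (∫ s in Ioi (0:ℝ), Real.exp (-((k:ℝ)+1) * s) * w s))) (β : ℝ) :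
    TendstoLocallyUniformly (fun n t => ∫ s in Ioc 0 t, Real.exp (-β * s) * r n s)
      (fun t => ∫ s in Ioc 0 t, Real.exp (-β * s) * w s) atTop := by
  -- integrability of h * r for h continuous, vanishing beyond M
  have hrep : ∀ (h : ℝ → ℝ) (M : ℝ) (_ : ∀ s, M ≤ s → h s = 0) (f : ℝ → ℝ) (s : ℝ),
      (fun x => Real.exp (-Real.log (max x (Real.exp (-M))) ) * 0 + 
        h (-Real.log (max x (Real.exp (-M)))) * Real.exp (-Real.log (max x (Real.exp (-M))))) (Real.exp (-s))
        * (Real.exp (-s) * f s) = h s * f s := by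
    intro h M hM f s
    rcases le_total s M with hs | hs
    · have : max (Real.exp (-s)) (Real.exp (-M)) = Real.exp (-s) :=
        max_eq_left (Real.exp_le_exp.2 (by linarith))
      simp only [this, Real.log_exp, neg_neg, mul_zero, zero_add]
      have : Real.exp s * Real.exp (-s) = 1 := by rw [← Real.exp_add]; simp
      linear_combination (h s * f s) * this
    · have : max (Real.exp (-s)) (Real.exp (-M)) = Real.exp (-M) :=
        max_eq_right (Real.exp_le_exp.2 (by linarith))
      simp only [this, Real.log_exp, neg_neg, mul_zero, zero_add, hM M le_rfl, hM s hs, zero_mul]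
  have hcg : ∀ (h : ℝ → ℝ) (_ : Continuous h) (M : ℝ), Continuous
      (fun x => Real.exp (-Real.log (max x (Real.exp (-M))) ) * 0 + 
        h (-Real.log (max x (Real.exp (-M)))) * Real.exp (-Real.log (max x (Real.exp (-M))))) := by
    intro h hh M
    have : Continuous fun x : ℝ => Real.log (max x (Real.exp (-M))) := by
      refine Continuous.log (by fun_prop) fun x => ?_
      exact (lt_of_lt_of_le (Real.exp_pos _) (le_max_right _ _)).ne'
    fun_prop
  have hconv : ∀ (h : ℝ → ℝ) (_ : Continuous h) (M : ℝ) (_ : ∀ s, M ≤ s → h s = 0),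
      Tendsto (fun n => ∫ s in Ioi (0:ℝ), h s * r n s) atTop (𝓝 (∫ s in Ioi (0:ℝ), h s * w s)) := by
    intro h hh M hM
    have := aux_lap_cont r w hr0 hw0 hri hwi hlim _ (hcg h hh M)
    simp only [hrep h M hM] at this
    exact this
  have hint : ∀ (h : ℝ → ℝ) (_ : Continuous h) (M : ℝ) (_ : ∀ s, M ≤ s → h s = 0) (f : ℝ → ℝ),
      IntegrableOn (fun s => Real.exp (-s) * f s) (Ioi 0) →
      IntegrableOn (fun s => h s * f s) (Ioi 0) := by
    intro h hh M hM f hf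
    obtain ⟨C, hC⟩ := (isCompact_Icc (a := (0:ℝ)) (b := 1)).exists_bound_of_continuousOn
      ((hcg h hh M).continuousOn)
    have : IntegrableOn (fun s => (fun x => Real.exp (-Real.log (max x (Real.exp (-M))) ) * 0 + 
        h (-Real.log (max x (Real.exp (-M)))) * Real.exp (-Real.log (max x (Real.exp (-M))))) (Real.exp (-s))
        * (Real.exp (-s) * f s)) (Ioi 0) := by
      refine Integrable.bdd_mul (c := C) hf ?_ ?_
      · exact ((hcg h hh M).comp (by fun_prop)).aestronglyMeasurable
      · exact (ae_restrict_mem measurableSet_Ioi).mono fun s hs => hC _ ⟨(Real.exp_pos _).le, 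
          Real.exp_le_one_iff.2 (by have := mem_Ioi.1 hs; linarith)⟩
    simpa only [hrep h M hM] using this
  have hKc : ∀ a δ : ℝ, Continuous fun s => Real.exp (-β * s) * auxK a δ s := by
    intro a δ; unfold auxK; fun_prop
  have hK0 : ∀ a δ : ℝ, 0 < δ → ∀ s, a + δ ≤ s → Real.exp (-β * s) * auxK a δ s = 0 := by
    intro a δ hδ s hs
    have : (a + δ - s) / δ ≤ 0 := div_nonpos_of_nonpos_of_nonneg (by linarith) hδ.le
    unfold auxK
    rw [max_eq_left ((min_le_right _ _).trans this), mul_zero]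
  have hKnn : ∀ a δ s : ℝ, 0 ≤ auxK a δ s := fun a δ s => le_max_left _ _
  have hKle : ∀ a δ s : ℝ, auxK a δ s ≤ 1 := fun a δ s => max_le zero_le_one (min_le_left _ _)
  have hK1 : ∀ a δ s : ℝ, 0 < δ → s ≤ a → auxK a δ s = 1 := by
    intro a δ s hδ hs
    have : 1 ≤ (a + δ - s) / δ := by rw [le_div_iff₀ hδ]; linarith
    unfold auxK
    rw [min_eq_left this, max_eq_right zero_le_one]
  have hIoc : ∀ (f : ℝ → ℝ), 
      IntegrableOn (fun s => Real.exp (-s) * f s) (Ioi 0) → ∀ t,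
      IntegrableOn (fun s => Real.exp (-β * s) * f s) (Ioc 0 t) := by
    intro f hf t
    refine ((hint _ (hKc t 1) (t + 1) (hK0 t 1 one_pos) f hf).mono_set Ioc_subset_Ioi_self).congr_fun ?_ measurableSet_Ioc
    intro s hs
    simp only [hK1 t 1 s one_pos hs.2, mul_one]
  have hup : ∀ (f : ℝ → ℝ), (∀ s, 0 ≤ f s) →
      IntegrableOn (fun s => Real.exp (-s) * f s) (Ioi 0) → ∀ t δ, 0 < δ →
      ∫ s in Ioc 0 t, Real.exp (-β * s) * f s ≤ ∫ s in Ioi (0:ℝ), Real.exp (-β * s) * auxK t δ s * f s := by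
    intro f hf0 hf t δ hδ
    have e : ∫ s in Ioc 0 t, Real.exp (-β * s) * f s = ∫ s in Ioc 0 t, Real.exp (-β * s) * auxK t δ s * f s := by
      refine setIntegral_congr_fun measurableSet_Ioc fun s hs => ?_
      simp only [hK1 t δ s hδ hs.2, mul_one]
    rw [e]
    refine setIntegral_mono_set (hint _ (hKc t δ) (t + δ) (hK0 t δ hδ) f hf) ?_ (Ioc_subset_Ioi_self.eventuallyLE)
    exact Eventually.of_forall fun s => mul_nonneg (mul_nonneg (Real.exp_pos _).le (hKnn _ _ _)) (hf0 s)
  have hdown : ∀ (f : ℝ → ℝ), (∀ s, 0 ≤ f s) →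
      IntegrableOn (fun s => Real.exp (-s) * f s) (Ioi 0) → ∀ t δ, 0 < δ →
      ∫ s in Ioi (0:ℝ), Real.exp (-β * s) * auxK t δ s * f s ≤ ∫ s in Ioc 0 (t + δ), Real.exp (-β * s) * f s := by
    intro f hf0 hf t δ hδ
    have e : ∫ s in Ioi (0:ℝ), Real.exp (-β * s) * auxK t δ s * f s
       = ∫ s in Ioc 0 (t + δ), Real.exp (-β * s) * auxK t δ s * f s := by
      refine setIntegral_eq_of_subset_of_forall_sdiff_eq_zero measurableSet_Ioi Ioc_subset_Ioi_self ?_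
      intro s hs
      have h1 : t + δ ≤ s := by
        by_contra hcon
        exact hs.2 ⟨hs.1, (not_le.1 hcon).le⟩
      rw [hK0 t δ hδ s h1, zero_mul]
    rw [e]
    refine setIntegral_mono_on ((hint _ (hKc t δ) (t + δ) (hK0 t δ hδ) f hf).mono_set Ioc_subset_Ioi_self)
      (hIoc f hf _) measurableSet_Ioc fun s hs => ?_
    refine mul_le_mul_of_nonneg_right ?_ (hf0 s)
    exact mul_le_of_le_one_right (Real.exp_pos _).le (hKle _ _ _)
  have hGc : Continuous fun t => ∫ s in Ioc 0 t, Real.exp (-β * s) * w s := by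
    have : (fun t => ∫ s in Ioc 0 t, Real.exp (-β * s) * w s) =
        fun t => ∫ s in (0:ℝ)..(max t 0), Real.exp (-β * s) * w s := by
      ext t
      rw [intervalIntegral.integral_of_le (le_max_right _ _)]
      rcases le_total t 0 with ht | ht
      · rw [max_eq_right ht, Ioc_eq_empty (not_lt.2 ht), Ioc_self]
      · rw [max_eq_left ht]
    rw [this]
    have h2 : Continuous fun u => ∫ s in (0:ℝ)..u, Real.exp (-β * s) * w s :=
      intervalIntegral.continuous_primitive (fun a b => (by fun_prop : Continuous fun s => Real.exp (-β * s) * w s).intervalIntegrable a b) 0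
    exact h2.comp (by fun_prop : Continuous fun t : ℝ => max t 0)
  refine aux_polya _ _ ?_ hGc ?_
  · filter_upwards [hri] with n hn s t hst
    refine setIntegral_mono_set (hIoc _ hn t) ?_ (Ioc_subset_Ioc_right hst).eventuallyLE
    exact Eventually.of_forall fun s => mul_nonneg (Real.exp_pos _).le (hr0 n s)
  · intro t
    rw [Metric.tendsto_nhds]
    intro ε hε
    obtain ⟨δ, hδ, hδ'⟩ := Metric.continuous_iff.1 hGc t (ε / 2) (by linarith)
    have ha := hδ' (t - δ / 2) (by rw [Real.dist_eq]; rw [abs_lt]; constructor <;> linarith)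
    have hb := hδ' (t + δ / 2) (by rw [Real.dist_eq]; rw [abs_lt]; constructor <;> linarith)
    have hδ2 : 0 < δ / 2 := by linarith
    have u1 := Metric.tendsto_nhds.1 (hconv _ (hKc t (δ/2)) (t + δ/2) (hK0 t (δ/2) hδ2)) (ε / 2) (by linarith)
    have u2 := Metric.tendsto_nhds.1 (hconv _ (hKc (t - δ/2) (δ/2)) _ (hK0 (t - δ/2) (δ/2) hδ2)) (ε / 2) (by linarith)
    have v1 := hdown w hw0 hwi t (δ/2) hδ2
    have v2 := hup w hw0 hwi (t - δ/2) (δ/2) hδ2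
    filter_upwards [hri, u1, u2] with n hn h1 h2
    have v3 := hup (r n) (hr0 n) hn t (δ/2) hδ2
    have v4 := hdown (r n) (hr0 n) hn (t - δ/2) (δ/2) hδ2
    rw [sub_add_cancel] at v4
    rw [Real.dist_eq, abs_lt] at *
    constructor <;> linarith [h1.1, h1.2, h2.1, h2.2, ha.1, ha.2, hb.1, hb.2]


theorem aux_conv_lap (Λ : Measure ℝ) [SFinite Λ] (f g : ℝ → ENNReal) (hf : Measurable f)
    (hg : Measurable g) (μ : ℝ) :
    ∫⁻ x in Ioi (0:ℝ), ENNReal.ofReal (Real.exp (-μ * x)) * ∫⁻ u in Icc 0 x, f (x - u) * g u ∂Λ =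
    (∫⁻ x in Ioi (0:ℝ), ENNReal.ofReal (Real.exp (-μ * x)) * f x) *
      ∫⁻ u in Ici (0:ℝ), ENNReal.ofReal (Real.exp (-μ * u)) * g u ∂Λ := by
  set E : ℝ → ENNReal := (Ici (0:ℝ)).indicator fun x => ENNReal.ofReal (Real.exp (-μ * x)) * f x with hE
  set G : ℝ → ENNReal := (Ici (0:ℝ)).indicator fun x => ENNReal.ofReal (Real.exp (-μ * x)) * g x with hG
  have hEm : Measurable E := (Measurable.mul (by fun_prop) hf).indicator measurableSet_Ici
  have hGm : Measurable G := (Measurable.mul (by fun_prop) hg).indicator measurableSet_Ici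
  have h1 : ∀ x ∈ Ici (0:ℝ), ENNReal.ofReal (Real.exp (-μ * x)) * ∫⁻ u in Icc 0 x, f (x - u) * g u ∂Λ
      = ∫⁻ u, E (x - u) * G u ∂Λ := by
    intro x hx
    rw [← lintegral_const_mul _ (by fun_prop), ← lintegral_indicator measurableSet_Icc]
    congr 1; ext u
    by_cases hu : u ∈ Icc 0 x
    · have h2 : x - u ∈ Ici (0:ℝ) := by simp; exact hu.2
      have h3 : u ∈ Ici (0:ℝ) := hu.1
      rw [indicator_of_mem hu, hE, hG, indicator_of_mem h2, indicator_of_mem h3]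
      have : Real.exp (-μ * x) = Real.exp (-μ * (x - u)) * Real.exp (-μ * u) := by
        rw [← Real.exp_add]; ring_nf
      rw [this, ENNReal.ofReal_mul (Real.exp_pos _).le]
      ring
    · rw [indicator_of_notMem hu]
      by_cases h3 : u ∈ Ici (0:ℝ)
      · have h2 : x - u ∉ Ici (0:ℝ) := fun h2 => hu ⟨h3, by simpa using h2⟩
        rw [hE, indicator_of_notMem h2, zero_mul]
      · rw [hG, indicator_of_notMem h3, mul_zero]
  have h2 : ∀ x ∉ Ici (0:ℝ), ∫⁻ u, E (x - u) * G u ∂Λ = 0 := by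
    intro x hx
    rw [← lintegral_zero (μ := Λ)]
    congr 1; ext u
    by_cases h3 : u ∈ Ici (0:ℝ)
    · have h2 : x - u ∉ Ici (0:ℝ) := fun h2 => hx (by simp at *; linarith)
      rw [hE, indicator_of_notMem h2, zero_mul]
    · rw [hG, indicator_of_notMem h3, mul_zero]
  rw [Measure.restrict_congr_set (Ioi_ae_eq_Ici (μ := volume) (a := (0:ℝ)))]
  rw [setLIntegral_congr_fun measurableSet_Ici h1, ← lintegral_indicator measurableSet_Ici]
  have h3 : (Ici (0:ℝ)).indicator (fun x => ∫⁻ u, E (x - u) * G u ∂Λ) = fun x => ∫⁻ u, E (x - u) * G u ∂Λ := by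
    rw [indicator_eq_self]
    intro x hx
    by_contra hcon
    exact hx (h2 x hcon)
  rw [h3, lintegral_lintegral_swap (by fun_prop), ← lintegral_indicator measurableSet_Ici,
    ← lintegral_indicator measurableSet_Ici, ← lintegral_const_mul _ hGm]
  congr 1; ext u
  rw [lintegral_mul_const _ (by fun_prop), lintegral_sub_right_eq_self]

theorem aux_convIter_cont (f : ℝ → ℝ) (hf : Continuous f) (k : ℕ) : Continuous (convIter f k) := by
  induction k with
  | zero => exact hf
  | succ k ih =>
    show Continuous fun x => ∫ y in (0:ℝ)..x, f (x - y) * convIter f k y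
    exact intervalIntegral.continuous_parametric_intervalIntegral_of_continuous (by fun_prop) continuous_id

theorem aux_convIter_bd (f : ℝ → ℝ) (hf : Continuous f) (C : ℝ) (hC : 0 ≤ C)
    (h0 : ∀ t, 0 ≤ t → 0 ≤ f t) (h1 : ∀ t, 0 ≤ t → f t ≤ C) (k : ℕ) :
    ∀ t, 0 ≤ t → 0 ≤ convIter f k t ∧ convIter f k t ≤ C ^ (k + 1) * (t ^ k / k.factorial) := by
  induction k with
  | zero => intro t ht; simpa [convIter] using ⟨h0 t ht, h1 t ht⟩
  | succ k ih =>
    intro t ht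
    have hc := aux_convIter_cont f hf k
    show 0 ≤ ∫ y in (0:ℝ)..t, f (t - y) * convIter f k y ∧ ∫ y in (0:ℝ)..t, f (t - y) * convIter f k y ≤ _
    constructor
    · refine intervalIntegral.integral_nonneg ht fun u hu => mul_nonneg (h0 _ (by linarith [hu.2])) (ih u hu.1).1
    · have : ∫ y in (0:ℝ)..t, f (t - y) * convIter f k y ≤ ∫ y in (0:ℝ)..t, C * (C ^ (k + 1) * (y ^ k / k.factorial)) := by
        refine intervalIntegral.integral_mono_on ht (Continuous.intervalIntegrable (by fun_prop) _ _) (Continuous.intervalIntegrable (by fun_prop) _ _) fun u hu => ?_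
        exact mul_le_mul (h1 _ (by linarith [hu.2])) (ih u hu.1).2 (ih u hu.1).1 hC
      refine this.trans (le_of_eq ?_)
      rw [intervalIntegral.integral_const_mul, intervalIntegral.integral_const_mul, intervalIntegral.integral_div, integral_pow]
      rw [Nat.factorial_succ]
      push_cast
      field_simp
      ring

theorem aux_res_bd (f : ℝ → ℝ) (hf : Continuous f) (C : ℝ) (hC : 0 ≤ C)
    (h0 : ∀ t, 0 ≤ t → 0 ≤ f t) (h1 : ∀ t, 0 ≤ t → f t ≤ C) (t : ℝ) :
    0 ≤ resolventSnd f t ∧ resolventSnd f t ≤ C * Real.exp (C * |t|) ∧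
      (0 ≤ t → Summable fun k => convIter f k t) := by
  have hs : HasSum (fun k : ℕ => C ^ (k + 1) * (|t| ^ k / k.factorial)) (C * Real.exp (C * |t|)) := by
    have := (NormedSpace.expSeries_div_hasSum_exp (C * |t|)).mul_left C
    rw [← Real.exp_eq_exp_ℝ] at this
    have e : (fun k : ℕ => C ^ (k + 1) * (|t| ^ k / k.factorial)) =
        fun k : ℕ => C * ((C * |t|) ^ k / k.factorial) := by
      ext k; rw [mul_pow]; ring
    rw [e]; exact this
  unfold resolventSnd
  split_ifs with ht
  · refine ⟨le_rfl, by positivity, fun h => absurd ht (not_lt.2 h)⟩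
  · push Not at ht
    have hb := fun k => aux_convIter_bd f hf C hC h0 h1 k t ht
    rw [abs_of_nonneg ht] at hs ⊢
    have hsum : Summable fun k => convIter f k t :=
      Summable.of_nonneg_of_le (fun k => (hb k).1) (fun k => (hb k).2) hs.summable
    refine ⟨tsum_nonneg fun k => (hb k).1, ?_, fun _ => hsum⟩
    rw [← hs.tsum_eq]
    exact hsum.tsum_le_tsum (fun k => (hb k).2) hs.summable

theorem aux_res_meas (f : ℝ → ℝ) (hf : Continuous f) (C : ℝ) (hC : 0 ≤ C)
    (h0 : ∀ t, 0 ≤ t → 0 ≤ f t) (h1 : ∀ t, 0 ≤ t → f t ≤ C) : Measurable (resolventSnd f) := by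
  have : resolventSnd f = fun t => if t < 0 then 0 else (∑' k, ENNReal.ofReal (convIter f k t)).toReal := by
    ext t
    unfold resolventSnd
    split_ifs with ht
    · rfl
    · push Not at ht
      rw [ENNReal.tsum_toReal_eq (fun k => ENNReal.ofReal_ne_top)]
      congr 1; ext k
      rw [ENNReal.toReal_ofReal (aux_convIter_bd f hf C hC h0 h1 k t ht).1]
  rw [this]
  refine Measurable.ite (measurableSet_Iio) measurable_const ?_
  refine (Measurable.tsum fun k => ?_).ennreal_toReal
  exact (aux_convIter_cont f hf k).measurable.ennreal_ofReal

theorem aux_convIter_lap (f : ℝ → ℝ) (hf : Continuous f) (C : ℝ) (hC : 0 ≤ C)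
    (h0 : ∀ t, 0 ≤ t → 0 ≤ f t) (h1 : ∀ t, 0 ≤ t → f t ≤ C) (μ : ℝ) (k : ℕ) :
    ∫⁻ x in Ioi (0:ℝ), ENNReal.ofReal (Real.exp (-μ * x)) * ENNReal.ofReal (convIter f k x)
      = (∫⁻ x in Ioi (0:ℝ), ENNReal.ofReal (Real.exp (-μ * x)) * ENNReal.ofReal (f x)) ^ (k + 1) := by
  induction k with
  | zero => simp [convIter]
  | succ k ih =>
    have hc := aux_convIter_cont f hf k
    have : ∀ x ∈ Ioi (0:ℝ), ENNReal.ofReal (Real.exp (-μ * x)) * ENNReal.ofReal (convIter f (k+1) x)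
        = ENNReal.ofReal (Real.exp (-μ * x)) * ∫⁻ u in Icc 0 x, ENNReal.ofReal (f (x - u)) * ENNReal.ofReal (convIter f k u) := by
      intro x hx
      have hx' := (mem_Ioi.1 hx).le
      congr 1
      show ENNReal.ofReal (∫ y in (0:ℝ)..x, f (x - y) * convIter f k y) = _
      rw [intervalIntegral.integral_of_le hx', ← integral_Icc_eq_integral_Ioc,
        ofReal_integral_eq_lintegral_ofReal]
      · refine setLIntegral_congr_fun measurableSet_Icc fun u hu => ?_
        exact ENNReal.ofReal_mul (h0 _ (by linarith [hu.2]))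
      · exact (Continuous.continuousOn (by fun_prop)).integrableOn_Icc
      · refine (ae_restrict_mem measurableSet_Icc).mono fun u hu => ?_
        exact mul_nonneg (h0 _ (by linarith [hu.2])) (aux_convIter_bd f hf C hC h0 h1 k u hu.1).1
    rw [setLIntegral_congr_fun measurableSet_Ioi this,
      aux_conv_lap volume (fun x => ENNReal.ofReal (f x)) (fun x => ENNReal.ofReal (convIter f k x)) (by fun_prop) (by fun_prop),
      ← Measure.restrict_congr_set (Ioi_ae_eq_Ici (μ := volume) (a := (0:ℝ))), ih]
    ring

theorem aux_res_lap (f : ℝ → ℝ) (hf : Continuous f) (C : ℝ) (hC : 0 ≤ C)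
    (h0 : ∀ t, 0 ≤ t → 0 ≤ f t) (h1 : ∀ t, 0 ≤ t → f t ≤ C) (μ q : ℝ) (hq0 : 0 ≤ q) (hq1 : q < 1)
    (hq : ∫⁻ x in Ioi (0:ℝ), ENNReal.ofReal (Real.exp (-μ * x)) * ENNReal.ofReal (f x) = ENNReal.ofReal q) :
    IntegrableOn (fun x => Real.exp (-μ * x) * resolventSnd f x) (Ioi 0) ∧
    ∫ x in Ioi (0:ℝ), Real.exp (-μ * x) * resolventSnd f x = q / (1 - q) := by
  have hm := aux_res_meas f hf C hC h0 h1
  have hsum : HasSum (fun k : ℕ => q ^ (k + 1)) (q / (1 - q)) := by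
    have := (hasSum_geometric_of_lt_one hq0 hq1).mul_left q
    have e : (fun k : ℕ => q ^ (k + 1)) = fun k : ℕ => q * q ^ k := by
      ext k; exact pow_succ' q k
    rw [e]; exact this
  have hl : ∫⁻ x in Ioi (0:ℝ), ENNReal.ofReal (Real.exp (-μ * x) * resolventSnd f x) = ENNReal.ofReal (q / (1 - q)) := by
    have : ∀ x ∈ Ioi (0:ℝ), ENNReal.ofReal (Real.exp (-μ * x) * resolventSnd f x) =
        ∑' k, ENNReal.ofReal (Real.exp (-μ * x)) * ENNReal.ofReal (convIter f k x) := by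
      intro x hx
      have hx' := (mem_Ioi.1 hx).le
      rw [ENNReal.ofReal_mul (Real.exp_pos _).le, ENNReal.tsum_mul_left]
      congr 1
      unfold resolventSnd
      rw [if_neg (not_lt.2 hx')]
      exact ENNReal.ofReal_tsum_of_nonneg (fun k => (aux_convIter_bd f hf C hC h0 h1 k x hx').1)
        ((aux_res_bd f hf C hC h0 h1 x).2.2 hx')
    rw [setLIntegral_congr_fun measurableSet_Ioi this, lintegral_tsum]
    · simp only [aux_convIter_lap f hf C hC h0 h1 μ, hq]
      rw [← hsum.tsum_eq, ENNReal.ofReal_tsum_of_nonneg (fun k => by positivity) hsum.summable]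
      simp only [ENNReal.ofReal_pow hq0]
    · intro k
      have := aux_convIter_cont f hf k
      fun_prop
  have hnn : ∀ x, 0 ≤ Real.exp (-μ * x) * resolventSnd f x := fun x =>
    mul_nonneg (Real.exp_pos _).le (aux_res_bd f hf C hC h0 h1 x).1
  have hmm : AEStronglyMeasurable (fun x => Real.exp (-μ * x) * resolventSnd f x) (volume.restrict (Ioi 0)) :=
    Measurable.aestronglyMeasurable (by fun_prop)
  constructor
  · refine ⟨hmm, ?_⟩
    rw [hasFiniteIntegral_iff_ofReal (Eventually.of_forall hnn), hl]
    exact ENNReal.ofReal_lt_top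
  · rw [integral_eq_lintegral_of_nonneg_ae (Eventually.of_forall hnn) hmm, hl, ENNReal.toReal_ofReal]
    exact div_nonneg hq0 (by linarith)


theorem aux_tail_lap (P : Measure ℝ) [IsFiniteMeasure P] (hP : P (Iio 0) = 0) (μ : ℝ) (hμ : 0 < μ) :
    ∫⁻ t in Ioi (0:ℝ), ENNReal.ofReal (Real.exp (-μ * t)) * P (Ici t) =
      ENNReal.ofReal ((P.real univ - ∫ u, Real.exp (-μ * u) ∂P) / μ) := by
  have hae : ∀ᵐ u ∂P, 0 ≤ u := by
    rw [ae_iff]; simpa [Iio, not_le] using hP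
  have hlc := lintegral_comp_eq_lintegral_meas_le_mul (f := id) (g := fun t => Real.exp (-μ * t)) P hae
    aemeasurable_id (fun t _ => Continuous.intervalIntegrable (by fun_prop) _ _)
    (Eventually.of_forall fun t => (Real.exp_pos _).le)
  have h1 : ∀ u : ℝ, ∫ t in (0:ℝ)..u, Real.exp (-μ * t) = (1 - Real.exp (-μ * u)) / μ := by
    intro u
    rw [intervalIntegral.integral_comp_mul_left (fun t => Real.exp t) (by linarith : -μ ≠ 0), integral_exp]
    simp
    field_simp
    ring
  have hI : Integrable (fun u => Real.exp (-μ * u)) P := by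
    refine Integrable.of_bound (C := 1) (by fun_prop) (hae.mono fun u hu => ?_)
    rw [Real.norm_of_nonneg (Real.exp_pos _).le, Real.exp_le_one_iff]
    nlinarith
  have h2 : ∫⁻ t in Ioi (0:ℝ), ENNReal.ofReal (Real.exp (-μ * t)) * P (Ici t) =
     ∫⁻ t in Ioi 0, P {a : ℝ | t ≤ id a} * ENNReal.ofReal (Real.exp (-μ * t)) := by
    congr 1; ext t; rw [mul_comm]; rfl
  rw [h2, ← hlc]
  simp only [id, h1]
  rw [← ofReal_integral_eq_lintegral_ofReal]
  · congr 1
    rw [integral_div, integral_sub (integrable_const _) hI]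
    simp
  · exact ((integrable_const _).sub hI).div_const _
  · refine hae.mono fun u hu => div_nonneg ?_ hμ.le
    simp only [sub_nonneg, Real.exp_le_one_iff]
    nlinarith

theorem aux_expDens_lap (c : ℝ) (hc : 0 < c) (μ : ℝ) (hμ : 0 ≤ μ) :
    ∫⁻ x in Ioi (0:ℝ), ENNReal.ofReal (Real.exp (-μ * x)) * ENNReal.ofReal (expDens c x)
      = ENNReal.ofReal (1 / (1 + c * μ)) := by
  have h1 : ∀ x : ℝ, ENNReal.ofReal (Real.exp (-μ * x)) * ENNReal.ofReal (expDens c x) =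
      ENNReal.ofReal ((1 / c) * Real.exp (-(μ + 1 / c) * x)) := by
    intro x
    rw [← ENNReal.ofReal_mul (Real.exp_pos _).le]
    congr 1
    unfold expDens
    have : Real.exp (-(μ + 1 / c) * x) = Real.exp (-μ * x) * Real.exp (-x / c) := by
      rw [← Real.exp_add]; congr 1; field_simp; ring
    rw [this]; ring
  have hneg : -(μ + 1 / c) < 0 := by
    have : 0 < 1 / c := by positivity
    linarith
  simp only [h1]
  rw [← ofReal_integral_eq_lintegral_ofReal]
  · rw [integral_const_mul, integral_exp_mul_Ioi hneg]
    congr 1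
    have h2 : 0 < 1 + c * μ := by positivity
    have h3 : -(μ + 1 / c) = -((1 + c * μ) / c) := by field_simp; ring
    rw [h3, mul_zero, Real.exp_zero]
    field_simp
  · exact (integrableOn_exp_mul_Ioi hneg 0).const_mul _
  · exact Eventually.of_forall fun x => by positivity

theorem aux_S (c : ℝ) (hc : 0 < c) (Λ : Measure ℝ) [IsProbabilityMeasure Λ] :
    Measurable (fun y => ∫ u in Icc (0:ℝ) y, expDens c (y - u) ∂Λ) ∧
    (∀ y, 0 ≤ ∫ u in Icc (0:ℝ) y, expDens c (y - u) ∂Λ) ∧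
    (∀ y, ENNReal.ofReal (∫ u in Icc (0:ℝ) y, expDens c (y - u) ∂Λ) =
      ∫⁻ u in Icc (0:ℝ) y, ENNReal.ofReal (expDens c (y - u)) * 1 ∂Λ) := by
  have hnn : ∀ y, 0 ≤ expDens c y := fun y => by unfold expDens; positivity
  have hci : ∀ (f : ℝ → ℝ) (_ : Continuous f) (y : ℝ), IntegrableOn f (Icc 0 y) Λ := fun f hf y =>
    hf.continuousOn.integrableOn_Icc
  have hce : Continuous (expDens c) := by unfold expDens; fun_prop
  refine ⟨?_, fun y => integral_nonneg fun u => hnn _, fun y => ?_⟩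
  · have h1 : (fun y => ∫ u in Icc (0:ℝ) y, expDens c (y - u) ∂Λ) = fun y => expDens c y * ∫ u in Icc (0:ℝ) y, Real.exp (u / c) ∂Λ := by
      ext y
      rw [← integral_const_mul]
      congr 1; ext u
      unfold expDens
      rw [mul_assoc, ← Real.exp_add]; congr 2; ring
    have hm : Monotone fun y => ∫ u in Icc (0:ℝ) y, Real.exp (u / c) ∂Λ := by
      intro x y hxy
      refine setIntegral_mono_set (hci _ (by fun_prop) y) (Eventually.of_forall fun u => (Real.exp_pos _).le) ?_
      exact (Icc_subset_Icc_right hxy).eventuallyLE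
    rw [h1]
    exact hce.measurable.mul hm.measurable
  · simp only [mul_one]
    rw [ofReal_integral_eq_lintegral_ofReal (hci _ (by fun_prop) y) (Eventually.of_forall fun u => hnn _)]

theorem aux_pi (c θ : ℝ) (hc : 0 < c) (hθ : 0 ≤ θ) (hθ1 : θ < 1) (Λ : Measure ℝ) [IsProbabilityMeasure Λ]
    (hΛ : Λ (Iic 0) = 0) :
    Continuous (piTail c θ Λ) ∧ (∀ t, 0 ≤ piTail c θ Λ t) ∧ (∀ t, 0 ≤ t → piTail c θ Λ t ≤ 1) ∧
    ∀ μ, 0 < μ → ∫⁻ x in Ioi (0:ℝ), ENNReal.ofReal (Real.exp (-μ * x)) * ENNReal.ofReal (piTail c θ Λ x)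
      = ENNReal.ofReal ((1 - 1 / (1 + c * μ) * (1 - θ + θ * ∫ u, Real.exp (-μ * u) ∂Λ)) / μ) := by
  obtain ⟨hSm, hS0, hSl⟩ := aux_S c hc Λ
  have hnn : ∀ y, 0 ≤ expDens c y := fun y => by unfold expDens; positivity
  have hce : Continuous (expDens c) := by unfold expDens; fun_prop
  have hpm : Measurable (piDens c θ Λ) := by
    unfold piDens
    exact (hce.measurable.const_mul _).add (hSm.const_mul _)
  have hp0 : ∀ y, 0 ≤ piDens c θ Λ y := fun y =>
    add_nonneg (mul_nonneg (by linarith) (hnn y)) (mul_nonneg hθ (hS0 y))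
  have hΛae : ∀ᵐ u ∂Λ, 0 < u := by
    rw [ae_iff]; simpa [Iic, not_lt] using hΛ
  have hΛr : Λ.restrict (Ici 0) = Λ := by
    refine Measure.restrict_eq_self_of_ae_mem (hΛae.mono fun u hu => hu.le)
  have hell : ∀ μ, 0 ≤ μ → Integrable (fun u => Real.exp (-μ * u)) Λ := by
    intro μ hμ
    refine Integrable.of_bound (C := 1) (by fun_prop) (hΛae.mono fun u hu => ?_)
    rw [Real.norm_of_nonneg (Real.exp_pos _).le, Real.exp_le_one_iff]
    nlinarith
  have hSlap : ∀ μ, 0 ≤ μ → ∫⁻ x in Ioi (0:ℝ), ENNReal.ofReal (Real.exp (-μ * x)) *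
      ENNReal.ofReal (∫ u in Icc (0:ℝ) x, expDens c (x - u) ∂Λ) =
      ENNReal.ofReal (1 / (1 + c * μ) * ∫ u, Real.exp (-μ * u) ∂Λ) := by
    intro μ hμ
    simp only [hSl]
    rw [aux_conv_lap Λ (fun x => ENNReal.ofReal (expDens c x)) (fun _ => 1) (by fun_prop) (by fun_prop),
      aux_expDens_lap c hc μ hμ, hΛr]
    simp only [mul_one]
    rw [← ofReal_integral_eq_lintegral_ofReal (hell μ hμ) (Eventually.of_forall fun u => (Real.exp_pos _).le),
      ENNReal.ofReal_mul (by positivity)]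
  have hlap : ∀ μ, 0 ≤ μ → ∫⁻ x in Ioi (0:ℝ), ENNReal.ofReal (Real.exp (-μ * x)) * ENNReal.ofReal (piDens c θ Λ x)
      = ENNReal.ofReal (1 / (1 + c * μ) * (1 - θ + θ * ∫ u, Real.exp (-μ * u) ∂Λ)) := by
    intro μ hμ
    have h1 : ∀ x, ENNReal.ofReal (Real.exp (-μ * x)) * ENNReal.ofReal (piDens c θ Λ x) =
        ENNReal.ofReal (1 - θ) * (ENNReal.ofReal (Real.exp (-μ * x)) * ENNReal.ofReal (expDens c x)) +
        ENNReal.ofReal θ * (ENNReal.ofReal (Real.exp (-μ * x)) *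
      ENNReal.ofReal (∫ u in Icc (0:ℝ) x, expDens c (x - u) ∂Λ)) := by
      intro x
      unfold piDens
      rw [ENNReal.ofReal_add (mul_nonneg (by linarith) (hnn x)) (mul_nonneg hθ (hS0 x)),
        ENNReal.ofReal_mul (by linarith), ENNReal.ofReal_mul hθ]
      ring
    simp only [h1]
    rw [lintegral_add_left (by fun_prop), lintegral_const_mul _ (by fun_prop), lintegral_const_mul _ (by fun_prop),
      hSlap μ hμ, aux_expDens_lap c hc μ hμ, ← ENNReal.ofReal_mul (by linarith), ← ENNReal.ofReal_mul hθ,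
      ← ENNReal.ofReal_add]
    · congr 1; ring
    · exact mul_nonneg (by linarith) (by positivity)
    · exact mul_nonneg hθ (mul_nonneg (by positivity) (integral_nonneg fun u => (Real.exp_pos _).le))
  have hone : ∫⁻ x in Ioi (0:ℝ), ENNReal.ofReal (piDens c θ Λ x) = 1 := by
    have := hlap 0 le_rfl
    simpa using this
  have hint0 : IntegrableOn (piDens c θ Λ) (Ioi 0) := by
    refine ⟨hpm.aestronglyMeasurable, ?_⟩
    rw [hasFiniteIntegral_iff_ofReal (Eventually.of_forall hp0), hone]
    exact ENNReal.one_lt_top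
  have hintx : ∀ x, IntegrableOn (piDens c θ Λ) (Ioi x) := by
    intro x
    have hneg : IntegrableOn (piDens c θ Λ) (Ioo x 0) := by
      have : IntegrableOn (fun y => (1 - θ) * expDens c y) (Ioo x 0) :=
        ((Continuous.continuousOn (by fun_prop)).integrableOn_Icc (a := x) (b := 0)).mono_set Ioo_subset_Icc_self
      refine this.congr_fun (fun y hy => ?_) measurableSet_Ioo
      simp only [piDens, Icc_eq_empty (not_le.2 hy.2)]
      simp
    have hI : IntegrableOn (piDens c θ Λ) (Ici 0) := (integrableOn_Ici_iff_integrableOn_Ioi (by simp)).2 hint0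
    refine (hneg.union hI).mono_set fun y hy => ?_
    rcases lt_or_ge y 0 with h | h
    · exact Or.inl ⟨hy, h⟩
    · exact Or.inr h
  have hcont : Continuous (piTail c θ Λ) := by
    have h1 : piTail c θ Λ = fun x => piTail c θ Λ 0 - ∫ y in (0:ℝ)..x, piDens c θ Λ y := by
      ext x
      unfold piTail
      rw [← intervalIntegral.integral_interval_add_Ioi (hintx 0) (hintx x)]
      ring
    rw [h1]
    refine continuous_const.sub (intervalIntegral.continuous_primitive (fun a b => ?_) 0)
    rw [intervalIntegrable_iff]
    exact (hintx (min a b)).mono_set (fun y hy => hy.1)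
  have ht0 : ∀ t, 0 ≤ piTail c θ Λ t := fun t => integral_nonneg hp0
  set P : Measure ℝ := (volume.restrict (Ioi (0:ℝ))).withDensity fun y => ENNReal.ofReal (piDens c θ Λ y) with hP
  have hPu : P univ = 1 := by
    rw [hP, withDensity_apply _ MeasurableSet.univ, Measure.restrict_univ, hone]
  have : IsProbabilityMeasure P := ⟨hPu⟩
  have hPt : ∀ t, 0 ≤ t → ENNReal.ofReal (piTail c θ Λ t) = P (Ici t) := by
    intro t ht
    rw [hP, withDensity_apply _ measurableSet_Ici, Measure.restrict_restrict measurableSet_Ici]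
    unfold piTail
    rw [ofReal_integral_eq_lintegral_ofReal (hintx t) (Eventually.of_forall hp0)]
    have : (Ici t ∩ Ioi 0 : Set ℝ) =ᵐ[volume] Ioi t := by
      have h1 : (Ici t ∩ Ioi 0 : Set ℝ) =ᵐ[volume] (Ioi t ∩ Ioi 0 : Set ℝ) :=
        (Ioi_ae_eq_Ici (μ := volume) (a := t)).symm.inter (ae_eq_refl _)
      rw [Ioi_inter_Ioi, sup_eq_left.2 ht] at h1
      exact h1
    rw [Measure.restrict_congr_set this]
  refine ⟨hcont, ht0, fun t ht => ?_, fun μ hμ => ?_⟩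
  · have h1 : P (Ici t) ≤ 1 := prob_le_one
    rw [← hPt t ht] at h1
    exact ENNReal.ofReal_le_one.1 h1
  · have h1 := aux_tail_lap P (by
      rw [hP, withDensity_apply _ measurableSet_Iio, Measure.restrict_restrict measurableSet_Iio]
      have : (Iio 0 ∩ Ioi 0 : Set ℝ) = ∅ := by
        ext x; simp only [mem_inter_iff, mem_Iio, mem_Ioi, mem_empty_iff_false]; constructor
        · rintro ⟨h, h'⟩; linarith
        · exact fun h => h.elim
      simp [this]) μ hμ
    rw [setLIntegral_congr_fun measurableSet_Ioi (g := fun t => ENNReal.ofReal (Real.exp (-μ * t)) * P (Ici t))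
      (fun t ht => by rw [hPt t (mem_Ioi.1 ht).le]), h1]
    congr 3
    · simp [Measure.real, hPu]
    · rw [integral_eq_lintegral_of_nonneg_ae (Eventually.of_forall fun u => (Real.exp_pos _).le) (by fun_prop),
        hP, lintegral_withDensity_eq_lintegral_mul _ (by fun_prop) (by fun_prop)]
      simp only [Pi.mul_apply]
      have h2 := hlap μ hμ.le
      simp only [mul_comm (ENNReal.ofReal (piDens c θ Λ _))]
      rw [h2, ENNReal.toReal_ofReal]
      refine mul_nonneg (by positivity) (add_nonneg (by linarith) (mul_nonneg hθ (integral_nonneg fun u => (Real.exp_pos _).le)))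


theorem aux_nu_fin (ν : Measure ℝ) 
    (hνint : ∫⁻ y in Set.Ioi (0 : ℝ), ENNReal.ofReal (min y (y ^ 2)) ∂ν ≠ ⊤) (a : ℝ) (ha : 0 < a) :
    ν (Ici a) ≠ ⊤ := by
  have h := mul_meas_ge_le_lintegral (μ := ν.restrict (Ioi 0)) (f := fun y => ENNReal.ofReal (min y (y ^ 2))) (by fun_prop)
    (ENNReal.ofReal (min a (a ^ 2)))
  have h1 : ν (Ici a) ≤ ν.restrict (Ioi 0) {x | ENNReal.ofReal (min a (a ^ 2)) ≤ ENNReal.ofReal (min x (x ^ 2))} := by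
    rw [Measure.restrict_apply (measurableSet_le (by fun_prop) (by fun_prop))]
    refine measure_mono fun x hx => ⟨?_, ?_⟩
    · have hx : a ≤ x := hx
      refine ENNReal.ofReal_le_ofReal (min_le_min hx ?_)
      gcongr
    · exact lt_of_lt_of_le ha hx
  have h2 : ENNReal.ofReal (min a (a ^ 2)) ≠ 0 := by
    simp only [ne_eq, ENNReal.ofReal_eq_zero, not_le]
    positivity
  intro h3
  rw [h3, top_le_iff] at h1
  rw [h1, ENNReal.mul_top h2, top_le_iff] at h
  exact hνint h

theorem aux_tail_meas (ν : Measure ℝ) : Measurable (tailNu ν) := by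
  have : Antitone fun y => ν (Ici y) := fun x y h => measure_mono (Ici_subset_Ici.2 h)
  exact this.measurable.ennreal_toReal

theorem aux_exp_bd (x : ℝ) (hx : 0 ≤ x) : 0 ≤ Real.exp (-x) - 1 + x ∧ Real.exp (-x) - 1 + x ≤ x ∧
    Real.exp (-x) - 1 + x ≤ x ^ 2 := by
  refine ⟨by linarith [Real.add_one_le_exp (-x)], ?_, ?_⟩
  · have : Real.exp (-x) ≤ 1 := Real.exp_le_one_iff.2 (by linarith)
    linarith
  · have h1 := Real.add_one_le_exp x
    have h2 : Real.exp (-x) * Real.exp x = 1 := by rw [← Real.exp_add]; simp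
    have h3 := Real.exp_pos (-x)
    have h4 : Real.exp (-x) * (x + 1) ≤ 1 := by nlinarith
    have h5 : Real.exp (-x) * (x + 1) ≤ (1 - x + x ^ 2) * (x + 1) := by nlinarith [pow_nonneg hx 3]
    have := le_of_mul_le_mul_right h5 (by linarith)
    linarith

theorem aux_phi (b c : ℝ) (ν : Measure ℝ) (hν0 : ν (Set.Iic 0) = 0)
    (hνint : ∫⁻ y in Set.Ioi (0 : ℝ), ENNReal.ofReal (min y (y ^ 2)) ∂ν ≠ ⊤) (l : ℝ) (hl : 0 < l) :
    IntegrableOn (fun z => (1 - Real.exp (-l * z)) * tailNu ν z) (Ioi 0) ∧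
    phi b c ν l = l * (b + c * l + ∫ z in Ioi (0:ℝ), (1 - Real.exp (-l * z)) * tailNu ν z) := by
  have hae : ∀ᵐ y ∂ν, 0 < y := by
    rw [ae_iff]; simpa [Iic, not_lt] using hν0
  have hr : ν.restrict (Ioi 0) = ν := Measure.restrict_eq_self_of_ae_mem hae
  rw [hr] at hνint
  have h1 : ∀ y : ℝ, ∫ t in (0:ℝ)..y, (1 - Real.exp (-l * t)) = (Real.exp (-l * y) - 1 + l * y) / l := by
    intro u
    rw [intervalIntegral.integral_sub (by simp) (Continuous.intervalIntegrable (by fun_prop) _ _),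
      intervalIntegral.integral_comp_mul_left (fun t => Real.exp t) (by linarith : -l ≠ 0), integral_exp]
    simp
    field_simp
    ring
  have hlc := lintegral_comp_eq_lintegral_meas_le_mul (f := id) (g := fun t => 1 - Real.exp (-l * t)) ν 
    (hae.mono fun y hy => hy.le)
    aemeasurable_id (fun t _ => Continuous.intervalIntegrable (by fun_prop) _ _)
    ((ae_restrict_mem measurableSet_Ioi).mono fun t ht => by
      have : Real.exp (-l * t) ≤ 1 := Real.exp_le_one_iff.2 (by have := mem_Ioi.1 ht; nlinarith)
      linarith)
  simp only [id, h1] at hlc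
  have hbd : ∀ y, 0 < y → (Real.exp (-l * y) - 1 + l * y) / l ≤ (1 + l) * min y (y ^ 2) := by
    intro y hy
    obtain ⟨_, h2, h3⟩ := aux_exp_bd (l * y) (by positivity)
    rw [div_le_iff₀ hl, neg_mul]
    rcases le_total y (y ^ 2) with h | h
    · rw [min_eq_left h]; nlinarith [mul_pos (mul_pos hl hl) hy]
    · rw [min_eq_right h]; nlinarith [mul_pos hl (mul_pos hy hy)]
  have hnn : ∀ y, 0 < y → 0 ≤ (Real.exp (-l * y) - 1 + l * y) / l := by
    intro y hy
    obtain ⟨h2, _⟩ := aux_exp_bd (l * y) (by positivity)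
    rw [neg_mul]
    positivity
  have hfin : ∫⁻ y, ENNReal.ofReal ((Real.exp (-l * y) - 1 + l * y) / l) ∂ν < ⊤ := by
    calc _ ≤ ∫⁻ y, ENNReal.ofReal (1 + l) * ENNReal.ofReal (min y (y ^ 2)) ∂ν := by
          refine lintegral_mono_ae (hae.mono fun y hy => ?_)
          rw [← ENNReal.ofReal_mul (by linarith)]
          exact ENNReal.ofReal_le_ofReal (hbd y hy)
      _ = ENNReal.ofReal (1 + l) * ∫⁻ y, ENNReal.ofReal (min y (y ^ 2)) ∂ν := lintegral_const_mul _ (by fun_prop)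
      _ < ⊤ := ENNReal.mul_lt_top ENNReal.ofReal_lt_top (lt_top_iff_ne_top.2 hνint)
  have hνi : Integrable (fun y => (Real.exp (-l * y) - 1 + l * y) / l) ν := by
    refine ⟨Measurable.aestronglyMeasurable (by fun_prop), ?_⟩
    rw [hasFiniteIntegral_iff_ofReal (hae.mono hnn)]
    exact hfin
  have hlc2 : ∫⁻ t in Ioi (0:ℝ), ENNReal.ofReal ((1 - Real.exp (-l * t)) * tailNu ν t) =
     ∫⁻ y, ENNReal.ofReal ((Real.exp (-l * y) - 1 + l * y) / l) ∂ν := by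
    rw [hlc]
    refine setLIntegral_congr_fun measurableSet_Ioi fun t ht => ?_
    have : Real.exp (-l * t) ≤ 1 := Real.exp_le_one_iff.2 (by have := mem_Ioi.1 ht; nlinarith)
    show ENNReal.ofReal ((1 - Real.exp (-l * t)) * tailNu ν t) = ν (Ici t) * ENNReal.ofReal (1 - Real.exp (-l * t))
    rw [ENNReal.ofReal_mul (by linarith), tailNu, ENNReal.ofReal_toReal (aux_nu_fin ν (by rwa [hr]) t ht), mul_comm]
  have hmt := aux_tail_meas ν
  have hnn2 : 0 ≤ᵐ[volume.restrict (Ioi 0)] fun t => (1 - Real.exp (-l * t)) * tailNu ν t := by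
    refine (ae_restrict_mem measurableSet_Ioi).mono fun t ht => mul_nonneg ?_ ENNReal.toReal_nonneg
    have : Real.exp (-l * t) ≤ 1 := Real.exp_le_one_iff.2 (by have := mem_Ioi.1 ht; nlinarith)
    linarith
  have hms : AEStronglyMeasurable (fun t => (1 - Real.exp (-l * t)) * tailNu ν t) (volume.restrict (Ioi 0)) :=
    Measurable.aestronglyMeasurable (by fun_prop)
  constructor
  · refine ⟨hms, ?_⟩
    rw [hasFiniteIntegral_iff_ofReal hnn2, hlc2]
    exact hfin
  · rw [integral_eq_lintegral_of_nonneg_ae hnn2 hms, hlc2, 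
      ← integral_eq_lintegral_of_nonneg_ae (hae.mono hnn) hνi.1, integral_div]
    unfold phi
    rw [hr]
    field_simp

theorem aux_I_bd (ν : Measure ℝ) (hν0 : ν (Set.Iic 0) = 0)
    (hνint : ∫⁻ y in Set.Ioi (0 : ℝ), ENNReal.ofReal (min y (y ^ 2)) ∂ν ≠ ⊤) (η : ℝ) (hη : 0 ≤ η)
    (hfin : ν (Ici η) ≠ ⊤) :
    IntegrableOn (tailNu ν) (Ioi η) ∧ 0 ≤ ∫ z in Ioi η, tailNu ν z ∧
    (∫ z in Ioi η, tailNu ν z) ^ 2 ≤ 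
      (tailNu ν η + 1) * (1 + 2 * ∫ z in Ioi (0:ℝ), (1 - Real.exp (-1 * z)) * tailNu ν z) ^ 2 := by
  obtain ⟨hi, _⟩ := aux_phi 0 0 ν hν0 hνint 1 one_pos
  have hmt := aux_tail_meas ν
  have htnn : ∀ z, 0 ≤ tailNu ν z := fun z => ENNReal.toReal_nonneg
  set N := tailNu ν η with hN
  set K := ∫ z in Ioi (0:ℝ), (1 - Real.exp (-1 * z)) * tailNu ν z with hK
  have hN0 : 0 ≤ N := htnn _
  set S := Real.sqrt (N + 1) with hS
  have hS1 : 1 ≤ S := by rw [hS, Real.one_le_sqrt]; linarith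
  have hS2 : S ^ 2 = N + 1 := Real.sq_sqrt (by linarith)
  set a := 1 / S with ha
  have ha0 : 0 < a := by positivity
  have ha1 : a ≤ 1 := by rw [ha, div_le_one (by linarith)]; exact hS1
  have hea : a / 2 ≤ 1 - Real.exp (-a) := by
    have h1 := Real.add_one_le_exp a
    have h2 : Real.exp (-a) * Real.exp a = 1 := by rw [← Real.exp_add]; simp
    have h3 := Real.exp_pos (-a)
    have h4 : Real.exp (-a) * (a + 1) ≤ 1 := by nlinarith
    nlinarith
  have hKnn : 0 ≤ K := by
    refine setIntegral_nonneg measurableSet_Ioi fun z hz => mul_nonneg ?_ (htnn z)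
    have : Real.exp (-1 * z) ≤ 1 := Real.exp_le_one_iff.2 (by have := mem_Ioi.1 hz; linarith)
    linarith
  have hptw : ∀ z ∈ Ioi η, tailNu ν z ≤ (Ioc 0 a).indicator (fun _ => N) z + (2 * S) * ((1 - Real.exp (-1 * z)) * tailNu ν z) := by
    intro z hz
    have hz' : η < z := hz
    have hz0 : 0 < z := lt_of_le_of_lt hη hz'
    have h1 : tailNu ν z ≤ N := ENNReal.toReal_mono hfin (measure_mono (Ici_subset_Ici.2 hz'.le))
    have h2 : Real.exp (-1 * z) ≤ 1 := Real.exp_le_one_iff.2 (by linarith)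
    have h3 : 0 ≤ (2 * S) * ((1 - Real.exp (-1 * z)) * tailNu ν z) :=
      mul_nonneg (by positivity) (mul_nonneg (by linarith) (htnn z))
    by_cases h : z ∈ Ioc 0 a
    · rw [indicator_of_mem h]; linarith
    · rw [indicator_of_notMem h, zero_add]
      have hza : a < z := by
        by_contra hcon
        exact h ⟨hz0, not_lt.1 hcon⟩
      have h4 : Real.exp (-1 * z) ≤ Real.exp (-a) := Real.exp_le_exp.2 (by linarith)
      have h5 : 1 ≤ 2 * S * (1 - Real.exp (-1 * z)) := by
        have : S * a = 1 := by rw [ha]; field_simp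
        nlinarith
      have := mul_le_mul_of_nonneg_right h5 (htnn z)
      linarith
  have hi1 : Integrable ((Ioc 0 a).indicator fun _ => N) :=
    (integrable_indicator_iff measurableSet_Ioc).2 (integrableOn_const (by simp))
  have hi2 : IntegrableOn (fun z => (Ioc 0 a).indicator (fun _ => N) z + (2 * S) * ((1 - Real.exp (-1 * z)) * tailNu ν z)) (Ioi η) :=
    hi1.integrableOn.add ((hi.mono_set (Ioi_subset_Ioi hη)).const_mul _)
  have hI : IntegrableOn (tailNu ν) (Ioi η) := by
    refine Integrable.mono' hi2 hmt.aestronglyMeasurable ((ae_restrict_mem measurableSet_Ioi).mono fun z hz => ?_)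
    rw [Real.norm_of_nonneg (htnn z)]; exact hptw z hz
  have hI0 : 0 ≤ ∫ z in Ioi η, tailNu ν z := integral_nonneg htnn
  refine ⟨hI, hI0, ?_⟩
  have hb : ∫ z in Ioi η, tailNu ν z ≤ a * N + 2 * S * K := by
    refine (setIntegral_mono_on hI hi2 measurableSet_Ioi hptw).trans ?_
    rw [integral_add hi1.integrableOn ((hi.mono_set (Ioi_subset_Ioi hη)).const_mul _), integral_const_mul]
    refine add_le_add ?_ (mul_le_mul_of_nonneg_left ?_ (by positivity))
    · calc ∫ z in Ioi η, (Ioc 0 a).indicator (fun _ => N) z ≤ ∫ z, (Ioc 0 a).indicator (fun _ => N) z :=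
            setIntegral_le_integral hi1 (Eventually.of_forall fun z => indicator_nonneg (fun _ _ => hN0) z)
        _ = a * N := by
            rw [integral_indicator measurableSet_Ioc]
            simp [ha0.le]
    · refine setIntegral_mono_set hi ((ae_restrict_mem measurableSet_Ioi).mono fun z hz => mul_nonneg ?_ (htnn z)) 
        (Ioi_subset_Ioi hη).eventuallyLE
      have : Real.exp (-1 * z) ≤ 1 := Real.exp_le_one_iff.2 (by have := mem_Ioi.1 hz; linarith)
      linarith
  have hb2 : ∫ z in Ioi η, tailNu ν z ≤ S * (1 + 2 * K) := by
    have : a * N ≤ S := by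
      rw [ha, div_mul_eq_mul_div, div_le_iff₀ (by linarith)]; nlinarith
    linarith
  calc (∫ z in Ioi η, tailNu ν z) ^ 2 ≤ (S * (1 + 2 * K)) ^ 2 := by gcongr
    _ = _ := by rw [mul_pow, hS2]

theorem aux_D_lim (ν : Measure ℝ) (hν0 : ν (Set.Iic 0) = 0)
    (hνint : ∫⁻ y in Set.Ioi (0 : ℝ), ENNReal.ofReal (min y (y ^ 2)) ∂ν ≠ ⊤) (η : ℕ → ℝ) (hη : ∀ n, 0 ≤ η n)
    (hlim : Tendsto η atTop (𝓝 0)) (l : ℝ) (hl : 0 < l) :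
    Tendsto (fun n => ∫ z in Ioi (η n), (1 - Real.exp (-l * (z - η n))) * tailNu ν z) atTop
      (𝓝 (∫ z in Ioi (0:ℝ), (1 - Real.exp (-l * z)) * tailNu ν z)) := by
  obtain ⟨hi, _⟩ := aux_phi 0 0 ν hν0 hνint l hl
  have hmt := aux_tail_meas ν
  have htnn : ∀ z, 0 ≤ tailNu ν z := fun z => ENNReal.toReal_nonneg
  have e : ∀ n, ∫ z in Ioi (η n), (1 - Real.exp (-l * (z - η n))) * tailNu ν z =
      ∫ z in Ioi (0:ℝ), (Ioi (η n)).indicator (fun z => (1 - Real.exp (-l * (z - η n))) * tailNu ν z) z := by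
    intro n
    rw [setIntegral_indicator measurableSet_Ioi, Ioi_inter_Ioi, sup_eq_right.2 (hη n)]
  simp only [e]
  refine tendsto_integral_of_dominated_convergence _ ?_ hi ?_ ?_
  · intro n
    exact (Measurable.indicator (by fun_prop) measurableSet_Ioi).aestronglyMeasurable
  · intro n
    refine (ae_restrict_mem measurableSet_Ioi).mono fun z hz => ?_
    have hz0 : 0 < z := hz
    have h1 : Real.exp (-l * z) ≤ 1 := Real.exp_le_one_iff.2 (by nlinarith)
    by_cases h : z ∈ Ioi (η n)
    · have h' : η n < z := h
      rw [indicator_of_mem h]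
      have h2 : Real.exp (-l * (z - η n)) ≤ 1 := Real.exp_le_one_iff.2 (by nlinarith)
      have h3 : Real.exp (-l * z) ≤ Real.exp (-l * (z - η n)) := Real.exp_le_exp.2 (by nlinarith [hη n])
      rw [Real.norm_of_nonneg (mul_nonneg (by linarith) (htnn z))]
      exact mul_le_mul_of_nonneg_right (by linarith) (htnn z)
    · rw [indicator_of_notMem h, norm_zero]
      exact mul_nonneg (by linarith) (htnn z)
  · refine (ae_restrict_mem measurableSet_Ioi).mono fun z hz => ?_
    have hz0 : 0 < z := hz
    have h1 : Tendsto (fun n => (1 - Real.exp (-l * (z - η n))) * tailNu ν z) atTop (𝓝 ((1 - Real.exp (-l * (z - 0))) * tailNu ν z)) := by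
      have hc : Continuous fun x : ℝ => (1 - Real.exp (-l * (z - x))) * tailNu ν z := by fun_prop
      exact (hc.tendsto 0).comp hlim
    rw [sub_zero] at h1
    refine h1.congr' ?_
    filter_upwards [hlim.eventually (gt_mem_nhds hz0)] with n hn
    rw [indicator_of_mem (mem_Ioi.2 hn)]


theorem aux_shift (F : ℝ → ℝ) (η : ℝ) : ∫ y in Ioi (0:ℝ), F (η + y) = ∫ z in Ioi η, F z := by
  have := (measurePreserving_add_left (volume : Measure ℝ) η).setIntegral_preimage_emb
    (measurableEmbedding_addLeft η) F (Ioi η)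
  simpa using this

theorem aux_ell (c θ η l : ℝ) (hη : 0 ≤ η) (hl : 0 < l) (ν Λ : Measure ℝ) (n : ℕ) (hn : 1 ≤ n)
    [IsProbabilityMeasure Λ] (hν0 : ν (Set.Iic 0) = 0)
    (hνint : ∫⁻ y in Set.Ioi (0 : ℝ), ENNReal.ofReal (min y (y ^ 2)) ∂ν ≠ ⊤)
    (hfin : ν (Ici η) ≠ ⊤) (hN : tailNu ν η ≠ 0) 
    (hΛ : Λ (Iic 0) = 0) (hΛtail : ∀ y : ℝ, 0 ≤ y →
      (Λ (Set.Ici y)).toReal = tailNu ν (η + y / (n : ℝ)) / tailNu ν η) :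
    ∫ u, Real.exp (-(l / n) * u) ∂Λ = 1 - l * (∫ z in Ioi η, Real.exp (-l * (z - η)) * tailNu ν z) / tailNu ν η := by
  have hn0 : (0:ℝ) < n := by exact_mod_cast hn
  have hmt := aux_tail_meas ν
  have htnn : ∀ z, 0 ≤ tailNu ν z := fun z => ENNReal.toReal_nonneg
  have h1 := aux_tail_lap Λ (measure_mono_null Iio_subset_Iic_self hΛ) (l / n) (by positivity)
  have hΛae : ∀ᵐ u ∂Λ, 0 < u := by
    rw [ae_iff]; simpa [Iic, not_lt] using hΛ
  have hle : ∫ u, Real.exp (-(l / n) * u) ∂Λ ≤ 1 := by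
    have : ∫ u, Real.exp (-(l / n) * u) ∂Λ ≤ ∫ u, (1:ℝ) ∂Λ := by
      refine integral_mono_of_nonneg (Eventually.of_forall fun u => (Real.exp_pos _).le) (integrable_const _) (hΛae.mono fun u hu => ?_)
      refine Real.exp_le_one_iff.2 ?_
      have : 0 < l / n := by positivity
      nlinarith
    simpa using this
  have h2 : ∫⁻ t in Ioi (0:ℝ), ENNReal.ofReal (Real.exp (-(l / n) * t)) * Λ (Ici t) =
      ∫⁻ t in Ioi (0:ℝ), ENNReal.ofReal (Real.exp (-l * ((n:ℝ)⁻¹ * t)) * tailNu ν (η + (n:ℝ)⁻¹ * t) / tailNu ν η) := by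
    refine setLIntegral_congr_fun measurableSet_Ioi fun t ht => ?_
    rw [mul_div_assoc, ENNReal.ofReal_mul (Real.exp_pos _).le, inv_mul_eq_div, ← hΛtail t (mem_Ioi.1 ht).le,
      ENNReal.ofReal_toReal (measure_ne_top _ _)]
    congr 3; field_simp
  rw [h2] at h1
  have h3 : ∫ t in Ioi (0:ℝ), Real.exp (-l * ((n:ℝ)⁻¹ * t)) * tailNu ν (η + (n:ℝ)⁻¹ * t) / tailNu ν η =
      (1 - ∫ u, Real.exp (-(l / n) * u) ∂Λ) / (l / n) := by
    rw [integral_eq_lintegral_of_nonneg_ae (Eventually.of_forall fun t => 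
      div_nonneg (mul_nonneg (Real.exp_pos _).le (htnn _)) (htnn _)) (Measurable.aestronglyMeasurable (by fun_prop)), h1, ENNReal.toReal_ofReal]
    · simp
    · refine div_nonneg ?_ (by positivity)
      simpa using hle
  have h4 := integral_comp_mul_left_Ioi (fun x => Real.exp (-l * x) * tailNu ν (η + x) / tailNu ν η) 0 (inv_pos.2 hn0)
  rw [h4, mul_zero, integral_div] at h3
  have h5 := aux_shift (fun z => Real.exp (-l * (z - η)) * tailNu ν z) η
  simp only [add_sub_cancel_left] at h5
  rw [h5, smul_eq_mul, inv_inv] at h3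
  have hl' : l / n ≠ 0 := by positivity
  rw [eq_div_iff hl'] at h3
  have : l * (∫ z in Ioi η, Real.exp (-l * (z - η)) * tailNu ν z) / tailNu ν η = 1 - ∫ u, Real.exp (-(l / n) * u) ∂Λ := by
    rw [← h3]; field_simp
  linarith

theorem aux_asym (b c l D : ℝ) (hb : 0 ≤ b) (hc : 0 < c) (hl : 0 < l) (hD : 0 ≤ D) (I J : ℕ → ℝ)
    (hJ0 : ∀ᶠ n in atTop, 0 ≤ J n) (hJI : ∀ᶠ n in atTop, J n ≤ I n)
    (hI : Tendsto (fun n => I n ^ 2 / (n:ℝ)) atTop (𝓝 0)) (hIJ : Tendsto (fun n => I n - J n) atTop (𝓝 D))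
    (q : ℕ → ℝ) (hq : ∀ᶠ n : ℕ in atTop, q n = max 0 (1 - b / n - (1 / n) * I n) * (1 + J n / n) / (1 + c * (l / n))) :
    (∀ᶠ n in atTop, 0 ≤ q n ∧ q n < 1) ∧
    Tendsto (fun n : ℕ => (1 / (n:ℝ)) * (q n / (1 - q n))) atTop (𝓝 (1 / (b + c * l + D))) := by
  have hinv : Tendsto (fun n : ℕ => (1 / (n:ℝ))) atTop (𝓝 0) := tendsto_one_div_atTop_nhds_zero_nat
  have hIn : Tendsto (fun n => I n / (n:ℝ)) atTop (𝓝 0) := by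
    have h1 : Tendsto (fun n => (I n / (n:ℝ)) ^ 2) atTop (𝓝 0) := by
      have := hI.mul hinv
      rw [mul_zero] at this
      refine this.congr fun n => ?_
      ring
    have h2 : Tendsto (fun n => Real.sqrt ((I n / (n:ℝ)) ^ 2)) atTop (𝓝 0) := by
      have := (Real.continuous_sqrt.tendsto 0).comp h1
      rw [Real.sqrt_zero] at this
      exact this
    simp only [Real.sqrt_sq_eq_abs] at h2
    exact (tendsto_zero_iff_abs_tendsto_zero _).2 h2
  have hJn : Tendsto (fun n => J n / (n:ℝ)) atTop (𝓝 0) := by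
    refine tendsto_of_tendsto_of_tendsto_of_le_of_le' tendsto_const_nhds hIn ?_ ?_
    · filter_upwards [hJ0] with n h; positivity
    · filter_upwards [hJI] with n h; gcongr
  have hIJn : Tendsto (fun n => I n * J n / (n:ℝ)) atTop (𝓝 0) := by
    refine tendsto_of_tendsto_of_tendsto_of_le_of_le' tendsto_const_nhds hI ?_ ?_
    · filter_upwards [hJ0, hJI] with n h h'
      have : 0 ≤ I n := h.trans h'
      positivity
    · filter_upwards [hJ0, hJI] with n h h'
      have : 0 ≤ I n := h.trans h'
      rw [sq]
      gcongr
  have hcl : Tendsto (fun n : ℕ => 1 + c * (l / (n:ℝ))) atTop (𝓝 1) := by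
    have := (hinv.const_mul (c * l)).const_add 1
    simp only [mul_zero, add_zero] at this
    refine this.congr fun n => ?_
    ring
  set E := b + c * l + D with hE
  have hE0 : 0 < E := by positivity
  have hX : Tendsto (fun n : ℕ => (c * l + b + (I n - J n) + (b * (J n / n) + I n * J n / n)) / (1 + c * (l / (n:ℝ)))) atTop (𝓝 E) := by
    have := ((hIJ.const_add (c * l + b)).add ((hJn.const_mul b).add hIJn)).div hcl one_ne_zero
    have hval : E = (c * l + b + D + (b * 0 + 0)) / 1 := by rw [hE]; ring
    rw [hval]; exact this
  have hpos : ∀ᶠ n : ℕ in atTop, 0 < 1 - b / n - (1 / n) * I n := by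
    have : Tendsto (fun n : ℕ => 1 - b / n - (1 / n) * I n) atTop (𝓝 1) := by
      have := ((hinv.const_mul b).const_sub 1).sub hIn
      simp only [mul_zero, sub_zero] at this
      refine this.congr fun n => ?_
      ring
    exact this.eventually (lt_mem_nhds zero_lt_one)
  have hqX : ∀ᶠ n : ℕ in atTop, (n:ℝ) * (1 - q n) = (c * l + b + (I n - J n) + (b * (J n / n) + I n * J n / n)) / (1 + c * (l / (n:ℝ))) := by
    filter_upwards [hq, hpos, eventually_ge_atTop 1] with n h1 h2 h3
    have hn0 : (0:ℝ) < n := by exact_mod_cast h3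
    have : 0 < 1 + c * (l / n) := by positivity
    rw [h1, max_eq_right h2.le, eq_div_iff this.ne', mul_assoc, sub_mul, div_mul_cancel₀ _ this.ne']
    field_simp
    ring
  have hXt : Tendsto (fun n : ℕ => (n:ℝ) * (1 - q n)) atTop (𝓝 E) := hX.congr' (hqX.mono fun n h => h.symm)
  have hq1 : ∀ᶠ n in atTop, 0 ≤ q n ∧ q n < 1 := by
    filter_upwards [hq, hXt.eventually (lt_mem_nhds hE0), eventually_ge_atTop 1, hJ0] with n h1 h2 h3 h4
    have hn0 : (0:ℝ) < n := by exact_mod_cast h3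
    refine ⟨?_, ?_⟩
    · rw [h1]
      have : 0 ≤ max 0 (1 - b / n - (1 / n) * I n) := le_max_left _ _
      positivity
    · have := (mul_pos_iff_of_pos_left hn0).1 h2
      linarith
  refine ⟨hq1, ?_⟩
  have hqt : Tendsto q atTop (𝓝 1) := by
    have := (hXt.mul hinv).const_sub 1
    rw [mul_zero, sub_zero] at this
    refine this.congr' ?_
    filter_upwards [eventually_ge_atTop 1] with n h3
    have hn0 : (0:ℝ) < n := by exact_mod_cast h3
    field_simp
    ring
  refine (hqt.div hXt hE0.ne').congr' ?_
  filter_upwards [eventually_ge_atTop 1, hq1] with n h3 h4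
  have hn0 : (0:ℝ) < n := by exact_mod_cast h3
  have : 1 - q n ≠ 0 := by linarith [h4.2]
  simp only [Pi.div_apply]
  field_simp

theorem aux_W (b c : ℝ) (hb : 0 ≤ b) (hc : 0 < c)
    (ν : Measure ℝ) (hν0 : ν (Set.Iic 0) = 0)
    (hνint : ∫⁻ y in Set.Ioi (0 : ℝ), ENNReal.ofReal (min y (y ^ 2)) ∂ν ≠ ⊤)
    (W W' : ℝ → ℝ)
    (hWnonneg : ∀ x : ℝ, 0 ≤ W x)
    (hWcont : ContinuousOn W (Set.Ici 0))
    (hWmono : StrictMonoOn W (Set.Ici 0))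
    (hWlap : ∀ l : ℝ, 0 < l →
      (∫ x in Set.Ioi (0 : ℝ), Real.exp (-l * x) * W x) = 1 / phi b c ν l)
    (hW'zero : W' 0 = 1 / c)
    (hW'deriv : ∀ x : ℝ, 0 < x → HasDerivAt W (W' x) x)
    (hW'cont : ContinuousOn W' (Set.Ici 0)) :
    (∀ x, 0 ≤ W' (max x 0)) ∧ Continuous (fun x => W' (max x 0)) ∧
    ∀ l : ℝ, 0 < l → IntegrableOn (fun x => Real.exp (-l * x) * W' (max x 0)) (Ioi 0) ∧
      ∫ x in Ioi (0:ℝ), Real.exp (-l * x) * W' (max x 0) =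
       1 / (b + c * l + ∫ z in Ioi (0:ℝ), (1 - Real.exp (-l * z)) * tailNu ν z) := by
  set w := fun x => W' (max x 0) with hw
  have hwc : Continuous w :=
    hW'cont.comp_continuous (by fun_prop) (fun x => mem_Ici.2 (le_max_right _ _))
  have hw0 : ∀ x, 0 ≤ w x := by
    intro x
    rcases le_or_gt x 0 with h | h
    · simp only [hw, max_eq_right h, hW'zero]; positivity
    · simp only [hw, max_eq_left h.le]
      have h1 := (hW'deriv x h).deriv
      rw [← h1, ← derivWithin_of_isOpen isOpen_Ioi (mem_Ioi.2 h)]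
      exact (hWmono.monotoneOn.mono Ioi_subset_Ici_self).derivWithin_nonneg
  have hD0 : ∀ l : ℝ, 0 < l → 0 ≤ ∫ z in Ioi (0:ℝ), (1 - Real.exp (-l * z)) * tailNu ν z := by
    intro l hl
    refine setIntegral_nonneg measurableSet_Ioi fun z hz => mul_nonneg ?_ ENNReal.toReal_nonneg
    have : Real.exp (-l * z) ≤ 1 := Real.exp_le_one_iff.2 (by have := mem_Ioi.1 hz; nlinarith)
    linarith
  have hphi := fun l (hl : 0 < l) => (aux_phi b c ν hν0 hνint l hl).2
  have hphipos : ∀ l, 0 < l → 0 < phi b c ν l := by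
    intro l hl
    rw [hphi l hl]
    have := hD0 l hl
    positivity
  have hWi : ∀ l, 0 < l → IntegrableOn (fun x => Real.exp (-l * x) * W x) (Ioi 0) := by
    intro l hl
    by_contra hcon
    have h1 := hWlap l hl
    rw [integral_undef hcon] at h1
    have := one_div_pos.2 (hphipos l hl)
    linarith
  have hW0 : W 0 = 0 := by
    have h1 : ∀ l, 0 < l → W 0 * (c * l) ≤ 1 := by
      intro l hl
      have h2 : W 0 * (1 / l) ≤ 1 / phi b c ν l := by
        rw [← hWlap l hl]
        have h3 : ∫ x in Ioi (0:ℝ), W 0 * Real.exp (-l * x) = W 0 * (1 / l) := by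
          rw [integral_const_mul, integral_exp_mul_Ioi (by linarith : -l < 0)]
          simp [neg_div_neg_eq]
        rw [← h3]
        refine setIntegral_mono_on ((integrableOn_exp_mul_Ioi (by linarith : -l < 0) 0).const_mul _) (hWi l hl) measurableSet_Ioi fun x hx => ?_
        rw [mul_comm]
        refine mul_le_mul_of_nonneg_left ?_ (Real.exp_pos _).le
        exact hWmono.monotoneOn (mem_Ici.2 le_rfl) (mem_Ici.2 (mem_Ioi.1 hx).le) (mem_Ioi.1 hx).le
      have h3 : l * (c * l) ≤ phi b c ν l := by
        rw [hphi l hl]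
        have := hD0 l hl
        gcongr
        linarith
      have h4 : 1 / phi b c ν l ≤ 1 / (l * (c * l)) := one_div_le_one_div_of_le (by positivity) h3
      have h5 := h2.trans h4
      have h6 := mul_le_mul_of_nonneg_right h5 (by positivity : 0 ≤ l * (c * l))
      have h7 : W 0 * (1 / l) * (l * (c * l)) = W 0 * (c * l) := by field_simp
      have h8 : 1 / (l * (c * l)) * (l * (c * l)) = 1 := by field_simp
      linarith
    by_contra hne
    have hpos : 0 < W 0 := lt_of_le_of_ne (hWnonneg 0) (Ne.symm hne)
    have := h1 (2 / (W 0 * c)) (by positivity)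
    have h2 : W 0 * (c * (2 / (W 0 * c))) = 2 := by field_simp
    linarith
  have hWint : ∀ x, 0 < x → W x = ∫ s in (0:ℝ)..x, w s := by
    intro x hx
    rw [intervalIntegral.integral_eq_sub_of_hasDerivAt_of_le hx.le (hWcont.mono Icc_subset_Ici_self)
      (fun s hs => by
        have := hW'deriv s hs.1
        simpa only [hw, max_eq_left hs.1.le] using this) (hwc.intervalIntegrable _ _), hW0, sub_zero]
  refine ⟨hw0, hwc, fun l hl => ?_⟩
  have hl1 : ∫⁻ x in Ioi (0:ℝ), ENNReal.ofReal (Real.exp (-l * x) * W x) = ENNReal.ofReal (1 / phi b c ν l) := by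
    rw [← hWlap l hl, ofReal_integral_eq_lintegral_ofReal (hWi l hl) (Eventually.of_forall fun x => mul_nonneg (Real.exp_pos _).le (hWnonneg x))]
  have hl2 : ∫⁻ x in Ioi (0:ℝ), ENNReal.ofReal (Real.exp (-l * x) * W x) =
      ENNReal.ofReal (1 / l) * ∫⁻ x in Ioi (0:ℝ), ENNReal.ofReal (Real.exp (-l * x) * w x) := by
    have h1 := aux_conv_lap volume (fun _ => 1) (fun x => ENNReal.ofReal (w x)) (by fun_prop) (by fun_prop) l
    rw [← Measure.restrict_congr_set (Ioi_ae_eq_Ici (μ := volume) (a := (0:ℝ)))] at h1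
    have h2 : ∫⁻ x in Ioi (0:ℝ), ENNReal.ofReal (Real.exp (-l * x)) * 1 = ENNReal.ofReal (1 / l) := by
      simp only [mul_one]
      rw [← ofReal_integral_eq_lintegral_ofReal (integrableOn_exp_mul_Ioi (by linarith : -l < 0) 0) (Eventually.of_forall fun x => (Real.exp_pos _).le),
        integral_exp_mul_Ioi (by linarith : -l < 0)]
      simp [neg_div_neg_eq]
    rw [h2] at h1
    simp only [ENNReal.ofReal_mul (Real.exp_pos _).le]
    rw [← h1]
    refine setLIntegral_congr_fun measurableSet_Ioi fun x hx => ?_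
    have hx' : 0 < x := hx
    simp only [one_mul]
    rw [hWint x hx', intervalIntegral.integral_of_le hx'.le, ← integral_Icc_eq_integral_Ioc,
      ofReal_integral_eq_lintegral_ofReal (hwc.continuousOn.integrableOn_Icc) (Eventually.of_forall hw0)]
  have hl3 : ∫⁻ x in Ioi (0:ℝ), ENNReal.ofReal (Real.exp (-l * x) * w x) = ENNReal.ofReal (l / phi b c ν l) := by
    have h1 : ENNReal.ofReal l * (ENNReal.ofReal (1 / l) * ∫⁻ x in Ioi (0:ℝ), ENNReal.ofReal (Real.exp (-l * x) * w x)) = ENNReal.ofReal (l / phi b c ν l) := by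
      rw [← hl2, hl1, ← ENNReal.ofReal_mul hl.le, mul_one_div]
    rw [← mul_assoc, ← ENNReal.ofReal_mul hl.le, mul_one_div_cancel hl.ne', ENNReal.ofReal_one, one_mul] at h1
    exact h1
  have hnn : ∀ x, 0 ≤ Real.exp (-l * x) * w x := fun x => mul_nonneg (Real.exp_pos _).le (hw0 x)
  have hms : AEStronglyMeasurable (fun x => Real.exp (-l * x) * w x) (volume.restrict (Ioi 0)) :=
    Continuous.aestronglyMeasurable (by fun_prop)
  refine ⟨⟨hms, ?_⟩, ?_⟩
  · rw [hasFiniteIntegral_iff_ofReal (Eventually.of_forall hnn), hl3]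
    exact ENNReal.ofReal_lt_top
  · rw [integral_eq_lintegral_of_nonneg_ae (Eventually.of_forall hnn) hms, hl3, ENNReal.toReal_ofReal (div_nonneg hl.le (hphipos l hl).le), hphi l hl]
    have := hD0 l hl
    field_simp


theorem aux_seq (c : ℝ) (hc : 0 < c)
    (ν : Measure ℝ) 
    (hνint : ∫⁻ y in Set.Ioi (0 : ℝ), ENNReal.ofReal (min y (y ^ 2)) ∂ν ≠ ⊤)
    (η θ : ℕ → ℝ) (hη : ∀ n : ℕ, 0 ≤ η n) 
    (hseq : (ν (Set.Ici (0 : ℝ)) ≠ ⊤ ∧ (∀ n : ℕ, 1 ≤ n → η n = 0) ∧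
        (∀ n : ℕ, 1 ≤ n → θ n = c * tailNu ν 0 / (n : ℝ) ^ 2)) ∨
      (ν (Set.Ici (0 : ℝ)) = ⊤ ∧
        Filter.Tendsto (fun n : ℕ => (n : ℝ) * θ n) Filter.atTop (nhds 0) ∧
        Filter.Tendsto (fun n : ℕ => (n : ℝ) ^ 2 * θ n) Filter.atTop Filter.atTop ∧
        (∀ n : ℕ, 1 ≤ n → tailNu ν (η n) = (n : ℝ) ^ 2 * θ n / c))) :
    Tendsto η atTop (𝓝 0) ∧ Tendsto (fun n : ℕ => tailNu ν (η n) / (n:ℝ)) atTop (𝓝 0) ∧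
    ∀ n : ℕ, 1 ≤ n → θ n = c * tailNu ν (η n) / (n : ℝ) ^ 2 := by
  rcases hseq with ⟨_, h1, h2⟩ | ⟨_, h1, h2, h3⟩
  · refine ⟨?_, ?_, fun n hn => by rw [h1 n hn]; exact h2 n hn⟩
    · refine tendsto_const_nhds.congr' ?_
      filter_upwards [eventually_ge_atTop 1] with n hn
      exact (h1 n hn).symm
    · refine (tendsto_const_div_atTop_nhds_zero_nat (tailNu ν 0)).congr' ?_
      filter_upwards [eventually_ge_atTop 1] with n hn
      rw [h1 n hn]
  · refine ⟨?_, ?_, fun n hn => ?_⟩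
    · rw [Metric.tendsto_nhds]
      intro ε hε
      filter_upwards [h2.eventually (eventually_gt_atTop (c * tailNu ν ε)), eventually_ge_atTop 1] with n hn hn1
      rw [Real.dist_eq, sub_zero, abs_of_nonneg (hη n)]
      by_contra hcon
      push Not at hcon
      have : tailNu ν (η n) ≤ tailNu ν ε := by
        unfold tailNu
        exact ENNReal.toReal_mono (aux_nu_fin ν hνint ε hε) (measure_mono (Ici_subset_Ici.2 hcon))
      rw [h3 n hn1, div_le_iff₀ hc] at this
      linarith
    · have := h1.div_const c
      rw [zero_div] at this
      refine this.congr' ?_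
      filter_upwards [eventually_ge_atTop 1] with n hn
      have hn0 : (0:ℝ) < n := by exact_mod_cast hn
      rw [h3 n hn]
      field_simp
    · have hn0 : (0:ℝ) < n := by exact_mod_cast hn
      rw [h3 n hn]
      field_simp

theorem aux_lap_RPi
    (b c : ℝ) (hb : 0 ≤ b) (hc : 0 < c)
    (ν : Measure ℝ) (hν0 : ν (Set.Iic 0) = 0)
    (hνint : ∫⁻ y in Set.Ioi (0 : ℝ), ENNReal.ofReal (min y (y ^ 2)) ∂ν ≠ ⊤)
    (η θ : ℕ → ℝ) (hη : ∀ n : ℕ, 0 ≤ η n) (hθ : ∀ n : ℕ, 0 ≤ θ n ∧ θ n < 1)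
    (hη0 : Tendsto η atTop (𝓝 0)) (hNn : Tendsto (fun n : ℕ => tailNu ν (η n) / (n:ℝ)) atTop (𝓝 0))
    (hθN : ∀ n : ℕ, 1 ≤ n → θ n = c * tailNu ν (η n) / (n : ℝ) ^ 2)
    (Λ : ℕ → Measure ℝ)
    (hΛprob : ∀ n : ℕ, 1 ≤ n → IsProbabilityMeasure (Λ n))
    (hΛsupp : ∀ n : ℕ, 1 ≤ n → Λ n (Set.Iic 0) = 0)
    (hΛtail : ∀ n : ℕ, 1 ≤ n → ∀ y : ℝ, 0 ≤ y →
      ((Λ n) (Set.Ici y)).toReal = tailNu ν (η n + y / (n : ℝ)) / tailNu ν (η n)) :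
    (∀ n : ℕ, 1 ≤ n → Measurable (RPi b c ν η θ Λ n) ∧ ∃ C, 0 ≤ C ∧ ∀ t, 0 ≤ RPi b c ν η θ Λ n t ∧
      RPi b c ν η θ Λ n t ≤ C * Real.exp (C * |t|)) ∧
    ∀ l : ℝ, 0 < l → (∀ᶠ n : ℕ in atTop, IntegrableOn (fun s => Real.exp (-l * s) * RPi b c ν η θ Λ n (n * s)) (Ioi 0)) ∧
      Tendsto (fun n : ℕ => ∫ s in Ioi (0:ℝ), Real.exp (-l * s) * RPi b c ν η θ Λ n (n * s)) atTop
        (𝓝 (1 / (b + c * l + ∫ z in Ioi (0:ℝ), (1 - Real.exp (-l * z)) * tailNu ν z))) := by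
  have htnn : ∀ z, 0 ≤ tailNu ν z := fun z => ENNReal.toReal_nonneg
  have hg0 : ∀ n, 0 ≤ gam b c ν η n := fun n => mul_nonneg (by positivity) (le_max_left _ _)
  have hf : ∀ n : ℕ, 1 ≤ n → Continuous (fun t => gam b c ν η n * piTail c (θ n) (Λ n) t) ∧
      (∀ t, 0 ≤ t → 0 ≤ gam b c ν η n * piTail c (θ n) (Λ n) t) ∧
      (∀ t, 0 ≤ t → gam b c ν η n * piTail c (θ n) (Λ n) t ≤ gam b c ν η n) := by
    intro n hn
    have := hΛprob n hn
    obtain ⟨h1, h2, h3, _⟩ := aux_pi c (θ n) hc (hθ n).1 (hθ n).2 (Λ n) (hΛsupp n hn)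
    refine ⟨continuous_const.mul h1, fun t _ => mul_nonneg (hg0 n) (h2 t), fun t ht => ?_⟩
    exact mul_le_of_le_one_right (hg0 n) (h3 t ht)
  refine ⟨fun n hn => ⟨aux_res_meas _ (hf n hn).1 _ (hg0 n) (hf n hn).2.1 (hf n hn).2.2, _, hg0 n, fun t => ?_⟩, ?_⟩
  · have := aux_res_bd _ (hf n hn).1 _ (hg0 n) (hf n hn).2.1 (hf n hn).2.2 t
    exact ⟨this.1, this.2.1⟩
  intro l hl
  have hNne : ∀ n : ℕ, 1 ≤ n → tailNu ν (η n) ≠ 0 := by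
    intro n hn h0
    have := hΛprob n hn
    have h1 := hΛtail n hn 0 le_rfl
    rw [h0, div_zero] at h1
    have h2 : Λ n (Ici 0) = 1 := by
      rw [prob_compl_eq_zero_iff measurableSet_Ici |>.symm, compl_Ici]
      exact measure_mono_null Iio_subset_Iic_self (hΛsupp n hn)
    rw [h2] at h1
    simp at h1
  have hfin : ∀ n : ℕ, 1 ≤ n → ν (Ici (η n)) ≠ ⊤ := by
    intro n hn h0
    apply hNne n hn
    simp [tailNu, h0]
  set I : ℕ → ℝ := fun n => ∫ z in Ioi (η n), tailNu ν z with hIdef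
  set J : ℕ → ℝ := fun n => ∫ z in Ioi (η n), Real.exp (-l * (z - η n)) * tailNu ν z with hJdef
  set D := ∫ z in Ioi (0:ℝ), (1 - Real.exp (-l * z)) * tailNu ν z with hDdef
  have hIb := fun n (hn : 1 ≤ n) => aux_I_bd ν hν0 hνint (η n) (hη n) (hfin n hn)
  have hJle : ∀ n, ∀ z ∈ Ioi (η n), Real.exp (-l * (z - η n)) ≤ 1 := by
    intro n z hz
    have : η n < z := hz
    exact Real.exp_le_one_iff.2 (by nlinarith)
  have hmt := aux_tail_meas ν
  have hJint : ∀ n, 1 ≤ n → IntegrableOn (fun z => Real.exp (-l * (z - η n)) * tailNu ν z) (Ioi (η n)) := by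
    intro n hn
    refine Integrable.mono' (hIb n hn).1 (Measurable.aestronglyMeasurable (by fun_prop)) ?_
    refine (ae_restrict_mem measurableSet_Ioi).mono fun z hz => ?_
    rw [Real.norm_of_nonneg (mul_nonneg (Real.exp_pos _).le (htnn _))]
    exact mul_le_of_le_one_left (htnn _) (hJle n z hz)
  have hJ0 : ∀ᶠ n in atTop, 0 ≤ J n := Eventually.of_forall fun n => 
    integral_nonneg fun z => mul_nonneg (Real.exp_pos _).le (htnn _)
  have hJI : ∀ᶠ n in atTop, J n ≤ I n := by
    filter_upwards [eventually_ge_atTop 1] with n hn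
    exact setIntegral_mono_on (hJint n hn) (hIb n hn).1 measurableSet_Ioi fun z hz => 
      mul_le_of_le_one_left (htnn _) (hJle n z hz)
  have hI2 : Tendsto (fun n => I n ^ 2 / (n:ℝ)) atTop (𝓝 0) := by
    set K := (1 + 2 * ∫ z in Ioi (0:ℝ), (1 - Real.exp (-1 * z)) * tailNu ν z) ^ 2
    have h1 : Tendsto (fun n : ℕ => (tailNu ν (η n) / (n:ℝ) + 1 / (n:ℝ)) * K) atTop (𝓝 0) := by
      have := (hNn.add tendsto_one_div_atTop_nhds_zero_nat).mul_const K
      rwa [add_zero, zero_mul] at this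
    refine tendsto_of_tendsto_of_tendsto_of_le_of_le' tendsto_const_nhds h1 ?_ ?_
    · exact Eventually.of_forall fun n => by positivity
    · filter_upwards [eventually_ge_atTop 1] with n hn
      have hn0 : (0:ℝ) < n := by exact_mod_cast hn
      rw [← add_div, div_mul_eq_mul_div]
      exact div_le_div_of_nonneg_right (hIb n hn).2.2 hn0.le
  have hIJ : Tendsto (fun n => I n - J n) atTop (𝓝 D) := by
    refine (aux_D_lim ν hν0 hνint η hη hη0 l hl).congr' ?_
    filter_upwards [eventually_ge_atTop 1] with n hn
    simp only [hIdef, hJdef]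
    rw [← integral_sub (hIb n hn).1 (hJint n hn)]
    congr 1; ext z; ring
  have hD0 : 0 ≤ D := by
    refine setIntegral_nonneg measurableSet_Ioi fun z hz => mul_nonneg ?_ (htnn _)
    have : Real.exp (-l * z) ≤ 1 := Real.exp_le_one_iff.2 (by have := mem_Ioi.1 hz; nlinarith)
    linarith
  set q : ℕ → ℝ := fun n => max 0 (1 - b / n - (1 / n) * I n) * (1 + J n / n) / (1 + c * (l / n)) with hq
  obtain ⟨hq01, hqlim⟩ := aux_asym b c l D hb hc hl hD0 I J hJ0 hJI hI2 hIJ q (Eventually.of_forall fun n => rfl)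
  have key : ∀ᶠ n : ℕ in atTop, IntegrableOn (fun s => Real.exp (-l * s) * RPi b c ν η θ Λ n (n * s)) (Ioi 0) ∧
      ∫ s in Ioi (0:ℝ), Real.exp (-l * s) * RPi b c ν η θ Λ n (n * s) = (1 / (n:ℝ)) * (q n / (1 - q n)) := by
    filter_upwards [hq01, eventually_ge_atTop 1] with n hqn hn
    have hn0 : (0:ℝ) < n := by exact_mod_cast hn
    have hpr := hΛprob n hn
    obtain ⟨_, _, _, h4⟩ := aux_pi c (θ n) hc (hθ n).1 (hθ n).2 (Λ n) (hΛsupp n hn)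
    have hqe : ∫⁻ x in Ioi (0:ℝ), ENNReal.ofReal (Real.exp (-(l / n) * x)) * ENNReal.ofReal (gam b c ν η n * piTail c (θ n) (Λ n) x) = ENNReal.ofReal (q n) := by
      simp only [ENNReal.ofReal_mul (hg0 n), mul_left_comm _ (ENNReal.ofReal (gam b c ν η n))]
      rw [lintegral_const_mul' _ _ ENNReal.ofReal_ne_top, h4 (l / n) (by positivity), ← ENNReal.ofReal_mul (hg0 n),
        aux_ell c (θ n) (η n) l (hη n) hl ν (Λ n) n hn hν0 hνint (hfin n hn) (hNne n hn) (hΛsupp n hn) (hΛtail n hn)]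
      congr 1
      have hgam : gam b c ν η n = 1 / c * max 0 (1 - b / n - (1 / n) * I n) := by
        simp only [gam, aux_shift (tailNu ν) (η n), hIdef]
      rw [hgam, hθN n hn]
      simp only [hq]
      change _ * ((1 - 1 / (1 + c * (l / n)) * (1 - c * tailNu ν (η n) / (n:ℝ) ^ 2 + c * tailNu ν (η n) / (n:ℝ) ^ 2 * (1 - l * J n / tailNu ν (η n)))) / (l / n)) = _
      have hN := hNne n hn
      have : 1 + c * (l / n) ≠ 0 := by positivity
      have h5 : 1 - c * tailNu ν (η n) / (n:ℝ) ^ 2 + c * tailNu ν (η n) / (n:ℝ) ^ 2 * (1 - l * J n / tailNu ν (η n)) = 1 - c * l * J n / (n:ℝ) ^ 2 := by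
        field_simp; ring
      rw [h5]
      generalize max 0 (1 - b / n - (1 / n) * I n) = M
      have h6 : 1 - 1 / (1 + c * (l / n)) * (1 - c * l * J n / (n:ℝ) ^ 2) = c * (l / n) * (1 + J n / n) / (1 + c * (l / n)) := by
        field_simp; ring
      rw [h6]
      field_simp
    obtain ⟨k1, k2⟩ := aux_res_lap _ (hf n hn).1 _ (hg0 n) (hf n hn).2.1 (hf n hn).2.2 (l / n) (q n) hqn.1 hqn.2 hqe
    set g := fun x => Real.exp (-(l / n) * x) * RPi b c ν η θ Λ n x with hg
    have e : (fun s : ℝ => Real.exp (-l * s) * RPi b c ν η θ Λ n (n * s)) = fun s => g (n * s) := by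
      funext s
      simp only [hg]
      congr 2
      field_simp
    rw [e]
    refine ⟨?_, ?_⟩
    · rw [integrableOn_Ioi_comp_mul_left_iff _ _ hn0, mul_zero]
      exact k1
    · rw [integral_comp_mul_left_Ioi _ _ hn0, mul_zero, smul_eq_mul, one_div, ← k2]
      rfl
  refine ⟨key.mono fun n h => h.1, hqlim.congr' (key.mono fun n h => h.2.symm)⟩


theorem aux_two (R : ℝ → ℝ) (hm : Measurable R) (C : ℝ) (hC : 0 ≤ C)
    (hR : ∀ t, 0 ≤ R t ∧ R t ≤ C * Real.exp (C * |t|)) (hneg : ∀ t, t < 0 → R t = 0)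
    (N y β : ℝ) (hN : 0 < N) (hy : 0 ≤ y) (hβ : 0 ≤ β) :
    Monotone (fun t => ∫ s in Ioc 0 t, Real.exp (-β * s) *
      ((if N * s < y then 1 else 0) + ∫ x in (N * s - y)..(N * s), R x)) ∧
    ∀ t, 0 ≤ t →
      y * (Real.exp (-β * (y / N)) * ∫ s in Ioc 0 (t - y / N), Real.exp (-β * s) * R (N * s)) ≤ 
        (∫ s in Ioc 0 t, Real.exp (-β * s) *
          ((if N * s < y then 1 else 0) + ∫ x in (N * s - y)..(N * s), R x)) ∧
      (∫ s in Ioc 0 t, Real.exp (-β * s) *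
          ((if N * s < y then 1 else 0) + ∫ x in (N * s - y)..(N * s), R x)) ≤
        y / N + y * ∫ s in Ioc 0 t, Real.exp (-β * s) * R (N * s) := by
  have e1 : ∀ s, ∫ x in (N * s - y)..(N * s), R x = ∫ x in Ioc 0 y, R (N * s - x) := by
    intro s
    rw [← intervalIntegral.integral_of_le hy, intervalIntegral.integral_comp_sub_left R (N * s), sub_zero]
  simp only [e1, mul_add]
  have hexp1 : ∀ s, 0 ≤ s → Real.exp (-β * s) ≤ 1 := fun s hs => Real.exp_le_one_iff.2 (by nlinarith)
  -- first part integrable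
  have hi1 : ∀ t, IntegrableOn (fun s => Real.exp (-β * s) * (if N * s < y then (1:ℝ) else 0)) (Ioc 0 t) := by
    intro t
    refine Integrable.mono' (integrable_const (1:ℝ)) (Measurable.aestronglyMeasurable ?_) ?_
    · refine Measurable.mul (by fun_prop) (Measurable.ite (measurableSet_lt (by fun_prop) (by fun_prop)) (by fun_prop) (by fun_prop))
    · refine (ae_restrict_mem measurableSet_Ioc).mono fun s hs => ?_
      have := hexp1 s hs.1.le
      have h2 := Real.exp_pos (-β * s)
      rw [Real.norm_eq_abs, abs_le]
      split_ifs <;> constructor <;> linarith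
  have hprod : ∀ t, Integrable (fun p : ℝ × ℝ => Real.exp (-β * p.1) * R (N * p.1 - p.2))
      ((volume.restrict (Ioc 0 t)).prod (volume.restrict (Ioc 0 y))) := by
    intro t
    refine Integrable.mono' (integrable_const (C * Real.exp (C * (N * t + y)))) (Measurable.aestronglyMeasurable ?_) ?_
    · exact Measurable.mul (by fun_prop) (hm.comp (by fun_prop))
    · rw [Measure.prod_restrict]
      refine (ae_restrict_mem (measurableSet_Ioc.prod measurableSet_Ioc)).mono fun p hp => ?_
      obtain ⟨⟨h1, h2⟩, h3, h4⟩ := hp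
      rw [Real.norm_of_nonneg (mul_nonneg (Real.exp_pos _).le (hR _).1)]
      refine (mul_le_of_le_one_left (hR _).1 (hexp1 _ h1.le)).trans ((hR _).2.trans ?_)
      gcongr
      rw [abs_le]
      constructor <;> nlinarith
  have hi2 : ∀ t, IntegrableOn (fun s => Real.exp (-β * s) * ∫ x in Ioc 0 y, R (N * s - x)) (Ioc 0 t) := by
    intro t
    have := (hprod t).integral_prod_left
    simp only [integral_const_mul] at this
    exact this
  have hH : ∀ t, IntegrableOn (fun s => Real.exp (-β * s) * R (N * s)) (Ioc 0 t) := by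
    intro t
    refine Integrable.mono' (integrable_const (C * Real.exp (C * (N * t)))) (Measurable.aestronglyMeasurable ?_) ?_
    · exact Measurable.mul (by fun_prop) (hm.comp (by fun_prop))
    · refine (ae_restrict_mem measurableSet_Ioc).mono fun p hp => ?_
      obtain ⟨h1, h2⟩ := hp
      rw [Real.norm_of_nonneg (mul_nonneg (Real.exp_pos _).le (hR _).1)]
      refine (mul_le_of_le_one_left (hR _).1 (hexp1 _ h1.le)).trans ((hR _).2.trans ?_)
      gcongr
      rw [abs_of_pos (by positivity)]
      gcongr
  have hn1 : ∀ s, 0 ≤ Real.exp (-β * s) * (if N * s < y then (1:ℝ) else 0) := fun s => by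
    split_ifs <;> positivity
  have hn2 : ∀ s, 0 ≤ Real.exp (-β * s) * ∫ x in Ioc 0 y, R (N * s - x) := fun s =>
    mul_nonneg (Real.exp_pos _).le (integral_nonneg fun x => (hR _).1)
  have hn3 : ∀ s, 0 ≤ Real.exp (-β * s) * R (N * s) := fun s => mul_nonneg (Real.exp_pos _).le (hR _).1
  have hHm : ∀ u t, u ≤ t → ∫ s in Ioc 0 u, Real.exp (-β * s) * R (N * s) ≤ ∫ s in Ioc 0 t, Real.exp (-β * s) * R (N * s) := 
    fun u t h => setIntegral_mono_set (hH t) (Eventually.of_forall hn3) (Ioc_subset_Ioc_right h).eventuallyLE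
  have hH0 : ∀ t, 0 ≤ ∫ s in Ioc 0 t, Real.exp (-β * s) * R (N * s) := fun t => integral_nonneg hn3
  refine ⟨?_, ?_⟩
  · intro u t h
    exact setIntegral_mono_set ((hi1 t).add (hi2 t)) (Eventually.of_forall fun s => add_nonneg (hn1 s) (hn2 s)) (Ioc_subset_Ioc_right h).eventuallyLE
  intro t ht
  rw [integral_add (hi1 t) (hi2 t)]
  have p0 : 0 ≤ ∫ s in Ioc 0 t, Real.exp (-β * s) * (if N * s < y then (1:ℝ) else 0) := integral_nonneg hn1
  have hyN : 0 ≤ y / N := by positivity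
  have p1 : ∫ s in Ioc 0 t, Real.exp (-β * s) * (if N * s < y then (1:ℝ) else 0) ≤ y / N := by
    have h1 : ∫ s in Ioc 0 t, Real.exp (-β * s) * (if N * s < y then (1:ℝ) else 0) ≤ ∫ s in Ioc 0 t, (Ioc 0 (y / N)).indicator (fun _ => (1:ℝ)) s := by
      refine setIntegral_mono_on (hi1 t) ?_ measurableSet_Ioc fun s hs => ?_
      · exact (integrable_const (1:ℝ)).indicator measurableSet_Ioc
      · by_cases h : N * s < y
        · rw [if_pos h, indicator_of_mem (mem_Ioc.2 ⟨hs.1, (le_div_iff₀ hN).2 (by linarith)⟩), mul_one]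
          exact hexp1 _ hs.1.le
        · rw [if_neg h, mul_zero]
          exact indicator_nonneg (fun _ _ => zero_le_one) _
    refine h1.trans ?_
    rw [setIntegral_indicator measurableSet_Ioc, setIntegral_const, smul_eq_mul, mul_one]
    have : volume.real (Ioc 0 t ∩ Ioc 0 (y / N)) ≤ volume.real (Ioc 0 (y / N)) := 
      measureReal_mono inter_subset_right (by simp)
    refine this.trans ?_
    rw [Real.volume_real_Ioc_of_le hyN, sub_zero]
  have hB : ∀ x, 0 ≤ x → ∫ s in Ioc 0 t, Real.exp (-β * s) * R (N * s - x) = 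
      Real.exp (-β * (x / N)) * ∫ s in Ioc 0 (t - x / N), Real.exp (-β * s) * R (N * s) := by
    intro x hx
    have hxN : 0 ≤ x / N := by positivity
    rw [← intervalIntegral.integral_of_le ht]
    have h1 := intervalIntegral.integral_comp_sub_right (a := 0) (b := t)
      (fun s => Real.exp (-β * (x / N)) * (Real.exp (-β * s) * R (N * s))) (x / N)
    have h2 : ∫ s in (0:ℝ)..t, Real.exp (-β * s) * R (N * s - x) = ∫ s in (0:ℝ)..t, Real.exp (-β * (x / N)) * (Real.exp (-β * (s - x / N)) * R (N * (s - x / N))) := by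
      congr 1; ext s
      rw [← mul_assoc, ← Real.exp_add]
      congr 2
      · ring
      · field_simp
    rw [h2, h1, intervalIntegral.integral_const_mul, intervalIntegral.integral_of_le (by linarith)]
    congr 1
    have h3 : ∫ s in Ioc (0 - x / N) (t - x / N), Real.exp (-β * s) * R (N * s) =
        ∫ s in Ioc (0 - x / N) (t - x / N), (Ioi (0:ℝ)).indicator (fun s => Real.exp (-β * s) * R (N * s)) s := by
      refine integral_congr_ae (ae_restrict_of_ae ?_)
      filter_upwards [(compl_mem_ae_iff.2 (by simp) : {(0:ℝ)}ᶜ ∈ ae volume)] with s hs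
      rcases lt_trichotomy s 0 with h | h | h
      · rw [indicator_of_notMem (by simpa using h.le), hneg _ (by nlinarith), mul_zero]
      · exact absurd h hs
      · rw [indicator_of_mem (mem_Ioi.2 h)]
    rw [h3, setIntegral_indicator measurableSet_Ioi]
    congr 2
    ext s
    simp only [mem_inter_iff, mem_Ioc, mem_Ioi]
    constructor
    · rintro ⟨⟨_, h⟩, h'⟩; exact ⟨h', h⟩
    · rintro ⟨h', h⟩; exact ⟨⟨by linarith, h⟩, h'⟩
  have hswap : ∫ s in Ioc 0 t, Real.exp (-β * s) * ∫ x in Ioc 0 y, R (N * s - x) =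
      ∫ x in Ioc 0 y, ∫ s in Ioc 0 t, Real.exp (-β * s) * R (N * s - x) := by
    simp only [← integral_const_mul]
    exact integral_integral_swap (f := fun s x => Real.exp (-β * s) * R (N * s - x)) (hprod t)
  have hBi : IntegrableOn (fun x => ∫ s in Ioc 0 t, Real.exp (-β * s) * R (N * s - x)) (Ioc 0 y) :=
    (hprod t).integral_prod_right
  have hcst : ∀ K : ℝ, ∫ x in Ioc 0 y, K = y * K := by
    intro K
    rw [setIntegral_const, Real.volume_real_Ioc_of_le hy, sub_zero, smul_eq_mul]
  rw [hswap]
  constructor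
  · have : y * (Real.exp (-β * (y / N)) * ∫ s in Ioc 0 (t - y / N), Real.exp (-β * s) * R (N * s)) ≤
        ∫ x in Ioc 0 y, ∫ s in Ioc 0 t, Real.exp (-β * s) * R (N * s - x) := by
      rw [← hcst]
      refine setIntegral_mono_on (integrable_const _) hBi measurableSet_Ioc fun x hx => ?_
      rw [hB x hx.1.le]
      have hxy : x / N ≤ y / N := div_le_div_of_nonneg_right hx.2 hN.le
      refine mul_le_mul (Real.exp_le_exp.2 ?_) (hHm _ _ (by linarith)) (hH0 _) (Real.exp_pos _).le
      nlinarith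
    linarith
  · have : ∫ x in Ioc 0 y, ∫ s in Ioc 0 t, Real.exp (-β * s) * R (N * s - x) ≤
        y * ∫ s in Ioc 0 t, Real.exp (-β * s) * R (N * s) := by
      rw [← hcst]
      refine setIntegral_mono_on hBi (integrable_const _) measurableSet_Ioc fun x hx => ?_
      rw [hB x hx.1.le]
      have hxN : 0 ≤ x / N := div_nonneg hx.1.le hN.le
      exact (mul_le_of_le_one_left (hH0 _) (hexp1 _ hxN)).trans (hHm _ _ (by linarith))
    linarith


/-- Lemma 4.5: locally uniform convergence of the time-scaled resolvents to `W′`. -/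
theorem stmt9
    (b c : ℝ) (hb : 0 ≤ b) (hc : 0 < c)
    (ν : Measure ℝ) (hν0 : ν (Set.Iic 0) = 0)
    (hνint : ∫⁻ y in Set.Ioi (0 : ℝ), ENNReal.ofReal (min y (y ^ 2)) ∂ν ≠ ⊤)
    (W W' : ℝ → ℝ)
    (hWneg : ∀ x : ℝ, x < 0 → W x = 0)
    (hWnonneg : ∀ x : ℝ, 0 ≤ W x)
    (hWcont : ContinuousOn W (Set.Ici 0))
    (hWmono : StrictMonoOn W (Set.Ici 0))
    (hWlap : ∀ l : ℝ, 0 < l →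
      (∫ x in Set.Ioi (0 : ℝ), Real.exp (-l * x) * W x) = 1 / phi b c ν l)
    (hW'neg : ∀ x : ℝ, x < 0 → W' x = 0)
    (hW'zero : W' 0 = 1 / c)
    (hW'deriv : ∀ x : ℝ, 0 < x → HasDerivAt W (W' x) x)
    (hW'cont : ContinuousOn W' (Set.Ici 0))
    (η θ : ℕ → ℝ) (hη : ∀ n : ℕ, 0 ≤ η n) (hθ : ∀ n : ℕ, 0 ≤ θ n ∧ θ n < 1)
    (hseq : (ν (Set.Ici (0 : ℝ)) ≠ ⊤ ∧ (∀ n : ℕ, 1 ≤ n → η n = 0) ∧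
        (∀ n : ℕ, 1 ≤ n → θ n = c * tailNu ν 0 / (n : ℝ) ^ 2)) ∨
      (ν (Set.Ici (0 : ℝ)) = ⊤ ∧
        Filter.Tendsto (fun n : ℕ => (n : ℝ) * θ n) Filter.atTop (nhds 0) ∧
        Filter.Tendsto (fun n : ℕ => (n : ℝ) ^ 2 * θ n) Filter.atTop Filter.atTop ∧
        (∀ n : ℕ, 1 ≤ n → tailNu ν (η n) = (n : ℝ) ^ 2 * θ n / c)))
    (Λ : ℕ → Measure ℝ)
    (hΛprob : ∀ n : ℕ, 1 ≤ n → IsProbabilityMeasure (Λ n))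
    (hΛsupp : ∀ n : ℕ, 1 ≤ n → Λ n (Set.Iic 0) = 0)
    (hΛtail : ∀ n : ℕ, 1 ≤ n → ∀ y : ℝ, 0 ≤ y →
      ((Λ n) (Set.Ici y)).toReal = tailNu ν (η n + y / (n : ℝ)) / tailNu ν (η n))
    :
    ∀ β : ℝ, 0 ≤ β → ∀ y : ℝ, 0 ≤ y → ∀ T : ℝ, 0 ≤ T →
      TendstoUniformlyOn
        (fun (n : ℕ) (t : ℝ) =>
          ∫ s in (0 : ℝ)..t, Real.exp (-β * s) * RPi b c ν η θ Λ n ((n : ℝ) * s))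
        (fun t : ℝ => ∫ s in (0 : ℝ)..t, Real.exp (-β * s) * W' s)
        Filter.atTop (Set.Icc 0 T) ∧
      TendstoUniformlyOn
        (fun (n : ℕ) (t : ℝ) =>
          ∫ s in (0 : ℝ)..t, Real.exp (-β * s) * Rtwo b c ν η θ Λ n ((n : ℝ) * s) y)
        (fun t : ℝ => y * ∫ s in (0 : ℝ)..t, Real.exp (-β * s) * W' s)
        Filter.atTop (Set.Icc 0 T) := by
  intro β hβ y hy T hT
  obtain ⟨hη0, hNn, hθN⟩ := aux_seq c hc ν hνint η θ hη hseq
  obtain ⟨hRb, hRl⟩ := aux_lap_RPi b c hb hc ν hν0 hνint η θ hη hθ hη0 hNn hθN Λ hΛprob hΛsupp hΛtail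
  obtain ⟨hw0, hwc, hwl⟩ := aux_W b c hb hc ν hν0 hνint W W' hWnonneg hWcont hWmono hWlap hW'zero hW'deriv hW'cont
  set w := fun x => W' (max x 0) with hw
  set r : ℕ → ℝ → ℝ := fun n s => if n = 0 then 0 else RPi b c ν η θ Λ n (n * s) with hr
  have hrn : ∀ n : ℕ, 1 ≤ n → r n = fun s => RPi b c ν η θ Λ n (n * s) := by
    intro n hn
    funext s
    simp only [hr, if_neg (show n ≠ 0 by omega)]
  have hr0 : ∀ n s, 0 ≤ r n s := by
    intro n s
    rcases Nat.eq_zero_or_pos n with h | h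
    · simp [hr, h]
    · rw [hrn n h]
      obtain ⟨_, C, _, hC⟩ := hRb n h
      exact (hC _).1
  have hri : ∀ᶠ n in atTop, IntegrableOn (fun s => Real.exp (-s) * r n s) (Ioi 0) := by
    filter_upwards [(hRl 1 one_pos).1, eventually_ge_atTop 1] with n h hn
    rw [hrn n hn]
    simpa only [neg_one_mul] using h
  have hwi : IntegrableOn (fun s => Real.exp (-s) * w s) (Ioi 0) := by
    simpa only [neg_one_mul] using (hwl 1 one_pos).1
  have hlim : ∀ k : ℕ, Tendsto (fun n => ∫ s in Ioi (0:ℝ), Real.exp (-((k:ℝ)+1) * s) * r n s) atTop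
      (𝓝 (∫ s in Ioi (0:ℝ), Real.exp (-((k:ℝ)+1) * s) * w s)) := by
    intro k
    have hk : (0:ℝ) < (k:ℝ) + 1 := by positivity
    rw [(hwl _ hk).2]
    refine (hRl _ hk).2.congr' ?_
    filter_upwards [eventually_ge_atTop 1] with n hn
    rw [hrn n hn]
  have main := aux_lap_main r w hr0 hw0 hwc hri hwi hlim β
  have hG : ∀ t, 0 ≤ t → ∫ s in Ioc 0 t, Real.exp (-β * s) * w s = ∫ s in (0:ℝ)..t, Real.exp (-β * s) * W' s := by
    intro t ht
    rw [intervalIntegral.integral_of_le ht]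
    refine setIntegral_congr_fun measurableSet_Ioc fun s hs => ?_
    simp only [hw, max_eq_left hs.1.le]
  set G : ℝ → ℝ := fun t => ∫ s in Ioc 0 t, Real.exp (-β * s) * w s with hGdef
  have hGc : Continuous G := by
    have h1 : G = fun t => ∫ s in (0:ℝ)..(max t 0), Real.exp (-β * s) * w s := by
      funext t
      simp only [hGdef]
      rw [intervalIntegral.integral_of_le (le_max_right _ _)]
      rcases le_total t 0 with h | h
      · rw [max_eq_right h, Ioc_eq_empty (by simpa using h), Ioc_self]
      · rw [max_eq_left h]
    rw [h1]
    exact (intervalIntegral.continuous_primitive (fun a b => Continuous.intervalIntegrable (by fun_prop) a b) 0).comp (by fun_prop)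
  have tocomp : ∀ (F : ℕ → ℝ → ℝ) (g : ℝ → ℝ), TendstoLocallyUniformly F g atTop → TendstoUniformlyOn F g atTop (Icc 0 T) :=
    fun F g h => (tendstoLocallyUniformlyOn_iff_tendstoUniformlyOn_of_compact isCompact_Icc).1 h.tendstoLocallyUniformlyOn
  refine ⟨?_, ?_⟩
  · refine ((tocomp _ _ main).congr ?_).congr_right ?_
    · filter_upwards [eventually_ge_atTop 1] with n hn t ht
      rw [hrn n hn]
      beta_reduce
      rw [intervalIntegral.integral_of_le ht.1]
    · intro t ht
      exact hG t ht.1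
  · set A : ℕ → ℝ → ℝ := fun n t => ∫ s in Ioc 0 t, Real.exp (-β * s) *
      ((if (n:ℝ) * s < y then 1 else 0) + ∫ x in ((n:ℝ) * s - y)..((n:ℝ) * s), RPi b c ν η θ Λ n x) with hA
    have two : ∀ n : ℕ, 1 ≤ n → Monotone (A n) ∧ ∀ t, 0 ≤ t →
        y * (Real.exp (-β * (y / n)) * ∫ s in Ioc 0 (t - y / n), Real.exp (-β * s) * r n s) ≤ A n t ∧
        A n t ≤ y / n + y * ∫ s in Ioc 0 t, Real.exp (-β * s) * r n s := by
      intro n hn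
      obtain ⟨h1, C, h2, h3⟩ := hRb n hn
      have hn0 : (0:ℝ) < n := by exact_mod_cast hn
      rw [hrn n hn]
      exact aux_two (RPi b c ν η θ Λ n) h1 C h2 h3 (fun t ht => by simp [RPi, resolventSnd, ht]) n y β hn0 hy hβ
    have hyn : Tendsto (fun n : ℕ => y / (n:ℝ)) atTop (𝓝 0) := tendsto_const_div_atTop_nhds_zero_nat y
    have hpt : ∀ t, Tendsto (fun n => A n t) atTop (𝓝 (y * G t)) := by
      intro t
      rcases lt_or_ge t 0 with h | h
      · have h1 : Ioc 0 t = ∅ := Ioc_eq_empty (by simpa using h.le)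
        simp only [hA, hGdef, h1, Measure.restrict_empty, integral_zero_measure, mul_zero]
        exact tendsto_const_nhds
      · have hlow : Tendsto (fun n : ℕ => y * (Real.exp (-β * (y / n)) * ∫ s in Ioc 0 (t - y / n), Real.exp (-β * s) * r n s)) atTop (𝓝 (y * G t)) := by
          have h1 : Tendsto (fun n : ℕ => Real.exp (-β * (y / n))) atTop (𝓝 1) := by
            have := (Real.continuous_exp.tendsto _).comp (hyn.const_mul (-β))
            rw [mul_zero, Real.exp_zero] at this
            exact this
          have h2 : Tendsto (fun n : ℕ => t - y / (n:ℝ)) atTop (𝓝 t) := by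
            have := hyn.const_sub t
            rwa [sub_zero] at this
          have h3 := main.tendsto_comp hGc.continuousAt h2
          have := (h1.mul h3).const_mul y
          rw [one_mul] at this
          exact this
        have hup : Tendsto (fun n : ℕ => y / n + y * ∫ s in Ioc 0 t, Real.exp (-β * s) * r n s) atTop (𝓝 (y * G t)) := by
          have h3 := main.tendsto_comp hGc.continuousAt (tendsto_const_nhds (x := t))
          have := hyn.add (h3.const_mul y)
          rw [zero_add] at this
          exact this
        refine tendsto_of_tendsto_of_tendsto_of_le_of_le' hlow hup ?_ ?_
        · filter_upwards [eventually_ge_atTop 1] with n hn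
          exact ((two n hn).2 t h).1
        · filter_upwards [eventually_ge_atTop 1] with n hn
          exact ((two n hn).2 t h).2
    have hpol := aux_polya A (fun t => y * G t) ((eventually_ge_atTop 1).mono fun n hn => (two n hn).1) (by fun_prop) hpt
    refine ((tocomp _ _ hpol).congr ?_).congr_right ?_
    · filter_upwards [eventually_ge_atTop 1] with n hn t ht
      simp only [hA]
      rw [intervalIntegral.integral_of_le ht.1]
      refine setIntegral_congr_fun measurableSet_Ioc fun s hs => ?_
      have hs0 : 0 ≤ (n:ℝ) * s := mul_nonneg (Nat.cast_nonneg n) hs.1.le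
      simp only [Rtwo, if_neg (show ¬ ((n:ℝ) * s < 0 ∨ y < 0) from by rintro (h | h) <;> linarith)]
    · intro t ht
      exact congrArg (fun z => y * z) (hG t ht.1)
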